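/- arXiv:1406.2999 — 2 statements merged into one kernel-verified Lean document; each statement's English description precedes it below -/
import Mathlib

section
/- Let p ≥ 5 be a prime, let k be a positive integer with p ≥ 2k−2, and let F ∈ ℤ_(p)[Q,R] be isobaric of weight k and not involving P. If F lies in (A^p, p)ⁿ for an integer n with 0 ≤ n ≤ k−1, then D^{p²}F lies in (A^p, p)^{n+2}; in other words, if v(F) ≤ k−1 then v(D^{p²}F) ≥ v(F) + 2. -/
open MvPolynomial Finset

noncomputable section

/-- `x` lies in `ℤ_(p) ⊆ ℚ`: `p` does not divide the reduced denominator of `x`. -/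
def pInt (p : ℕ) (x : ℚ) : Prop := ¬ p ∣ x.den

/-- The polynomial ring `ℚ[P,Q,R]`, with `P = X 0`, `Q = X 1`, `R = X 2`. -/
abbrev Poly3 : Type := MvPolynomial (Fin 3) ℚ

/-- `f` has all of its coefficients in `ℤ_(p)`. -/
def polyPInt (p : ℕ) (f : Poly3) : Prop := ∀ m : Fin 3 →₀ ℕ, pInt p (coeff m f)

/-- `f` is isobaric of weight `w`, where `P, Q, R` have weights `2, 4, 6`. -/
def Isobaric (w : ℕ) (f : Poly3) : Prop :=
  ∀ m ∈ f.support, 2 * m 0 + 4 * m 1 + 6 * m 2 = w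

/-- `f` does not involve the variable `P`. -/
def NoP (f : Poly3) : Prop := ∀ m ∈ f.support, m 0 = 0

/-- The Ramanujan derivation `D` on `ℚ[P,Q,R]`, the unique derivation with
`DP = (P²-Q)/12`, `DQ = (PQ-R)/3`, `DR = (PR-Q²)/2`. -/
def Dop (f : Poly3) : Poly3 :=
  C (1/12 : ℚ) * (X 0 ^ 2 - X 1) * pderiv 0 f
    + C (1/3 : ℚ) * (X 0 * X 1 - X 2) * pderiv 1 f
    + C (1/2 : ℚ) * (X 0 * X 2 - X 1 ^ 2) * pderiv 2 f

/-- The sum of the `j`-th powers of the divisors of `n`, as a rational number. -/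
def sigmaQ (j n : ℕ) : ℚ := ∑ d ∈ n.divisors, (d : ℚ) ^ j

/-- The q-expansion of `E₂`. -/
def E2s : PowerSeries ℚ := PowerSeries.mk fun n => if n = 0 then 1 else -24 * sigmaQ 1 n

/-- The q-expansion of `E₄`. -/
def E4s : PowerSeries ℚ := PowerSeries.mk fun n => if n = 0 then 1 else 240 * sigmaQ 3 n

/-- The q-expansion of `E₆`. -/
def E6s : PowerSeries ℚ := PowerSeries.mk fun n => if n = 0 then 1 else -504 * sigmaQ 5 n

/-- The q-expansion of the normalized Eisenstein series `E_{p-1}`. -/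
def EAs (p : ℕ) : PowerSeries ℚ :=
  PowerSeries.mk fun n => if n = 0 then 1 else
    -(2 * ((p : ℚ) - 1) / bernoulli (p - 1)) * sigmaQ (p - 2) n

/-- The q-expansion of the normalized Eisenstein series `E_{p+1}`. -/
def EBs (p : ℕ) : PowerSeries ℚ :=
  PowerSeries.mk fun n => if n = 0 then 1 else
    -(2 * ((p : ℚ) + 1) / bernoulli (p + 1)) * sigmaQ p n

/-- `Φ : ℚ[P,Q,R] → ℚ[[q]]`, the algebra map sending `P, Q, R` to `E₂, E₄, E₆`. -/
def Phi : Poly3 →ₐ[ℚ] PowerSeries ℚ := aeval ![E2s, E4s, E6s]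

/-- The theta operator attached to the polynomials `A` and `B`:
`θf = ((BQ-AR)/3)·∂f/∂Q + ((BR-AQ²)/2)·∂f/∂R`. -/
def thetaOp (A B f : Poly3) : Poly3 :=
  C (1/3 : ℚ) * (B * X 1 - A * X 2) * pderiv 1 f
    + C (1/2 : ℚ) * (B * X 2 - A * X 1 ^ 2) * pderiv 2 f

/-- `f` lies in the `n`-th power of the ideal `(A^p, p)` of `ℤ_(p)[P,Q,R]`. -/
def InIdealPow (p : ℕ) (A : Poly3) (n : ℕ) (f : Poly3) : Prop :=
  ∃ G : ℕ → Poly3, (∀ i, polyPInt p (G i)) ∧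
    f = ∑ i ∈ Finset.range (n + 1), (p : Poly3) ^ (n - i) * A ^ (p * i) * G i

namespace RamId

section Analytic

open UpperHalfPlane Function ModularForm EisensteinSeries
open scoped Real MatrixGroups Topology Manifold

/-- `f` is holomorphic on the upper half plane, with `q`-expansion `s`. -/
def Rep (s : PowerSeries ℂ) (f : ℍ → ℂ) : Prop :=
  MDiff f ∧ ∀ τ : ℍ, HasSum (fun m : ℕ => PowerSeries.coeff m s • Periodic.qParam 1 τ ^ m) (f τ)

lemma Rep.bdd {s : PowerSeries ℂ} {f : ℍ → ℂ} (h : Rep s f) : IsBoundedAtImInfty f :=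
  isBoundedAtImInfty_of_hasSum_qExpansion one_pos h.2

lemma Rep.per {s : PowerSeries ℂ} {f : ℍ → ℂ} (h : Rep s f) :
    Periodic (f ∘ ofComplex) ((1 : ℝ) : ℂ) := by
  intro w
  by_cases hw : 0 < w.im
  · have hw' : 0 < (w + ((1 : ℝ) : ℂ)).im := by simpa using hw
    simp only [comp_apply, ofComplex_apply_of_im_pos hw', ofComplex_apply_of_im_pos hw]
    refine (h.2 _).unique ?_
    have h2 := h.2 ⟨w, hw⟩
    have : Periodic.qParam 1 (w + ((1 : ℝ) : ℂ)) = Periodic.qParam 1 w := by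
      simp only [Periodic.qParam, Complex.ofReal_one, div_one]
      rw [mul_add, mul_one, Complex.exp_add, Complex.exp_two_pi_mul_I, mul_one]
    simp only [this]
    exact h2
  · push Not at hw
    have hw' : (w + ((1 : ℝ) : ℂ)).im ≤ 0 := by simpa using hw
    simp only [comp_apply, ofComplex_apply_of_im_nonpos hw', ofComplex_apply_of_im_nonpos hw]

lemma Rep.ana {s : PowerSeries ℂ} {f : ℍ → ℂ} (h : Rep s f) :
    AnalyticAt ℂ (cuspFunction 1 f) 0 :=
  analyticAt_cuspFunction_zero one_pos h.per h.1 h.bdd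

lemma Rep.qexp {s : PowerSeries ℂ} {f : ℍ → ℂ} (h : Rep s f) : qExpansion 1 f = s := by
  ext m
  have h1 := (hasFPowerSeriesOnBall_cuspFunction one_pos h.ana h.2).hasFPowerSeriesAt
  have h2 : HasFPowerSeriesAt (cuspFunction 1 f)
      (.ofScalars ℂ fun m => PowerSeries.coeff m (qExpansion 1 f)) 0 := by
    simpa [qExpansion_coeff, div_eq_mul_inv, mul_comm] using h.ana.hasFPowerSeriesAt
  simpa using (congr_arg (FormalMultilinearSeries.coeff · m) (h1.eq_formalMultilinearSeries h2)).symm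

lemma rep_of {f : ℍ → ℂ} (hper : Periodic (f ∘ ofComplex) ((1 : ℝ) : ℂ)) (hd : MDiff f)
    (hb : IsBoundedAtImInfty f) : Rep (qExpansion 1 f) f :=
  ⟨hd, fun τ => hasSum_qExpansion one_pos hper hd hb τ⟩

lemma Rep.add {s t : PowerSeries ℂ} {f g : ℍ → ℂ} (hf : Rep s f) (hg : Rep t g) :
    Rep (s + t) (f + g) := by
  refine ⟨hf.1.add hg.1, fun τ => ?_⟩
  simpa [add_mul] using (hf.2 τ).add (hg.2 τ)

lemma Rep.smul {s : PowerSeries ℂ} {f : ℍ → ℂ} (c : ℂ) (hf : Rep s f) :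
    Rep (c • s) (c • f) := by
  refine ⟨hf.1.const_smul c, fun τ => ?_⟩
  simpa [mul_assoc] using (hf.2 τ).mul_left c

lemma Rep.mul {s t : PowerSeries ℂ} {f g : ℍ → ℂ} (hf : Rep s f) (hg : Rep t g) :
    Rep (s * t) (f * g) := by
  have h := rep_of (f := f * g) (fun w => by
    have h1 := hf.per w
    have h2 := hg.per w
    simp only [comp_apply, Pi.mul_apply] at h1 h2 ⊢
    rw [h1, h2]) (hf.1.mul hg.1) (hf.bdd.mul hg.bdd)
  rwa [qExpansion_mul hf.ana hg.ana, hf.qexp, hg.qexp] at h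

/-- The operator `q d/dq` on power series. -/
def thC (s : PowerSeries ℂ) : PowerSeries ℂ := PowerSeries.mk fun n => (n : ℂ) * PowerSeries.coeff n s

lemma Rep.deriv {s : PowerSeries ℂ} {f : ℍ → ℂ} (hf : Rep s f) :
    Rep (thC s) (Derivative.normalizedDerivOfComplex f) := by
  refine ⟨Derivative.normalizedDerivOfComplex_mdifferentiable hf.1, fun τ => ?_⟩
  set g := cuspFunction 1 f with hg
  have hq : ‖Periodic.qParam 1 (τ : ℂ)‖ < 1 := Periodic.norm_qParam_lt_one one_pos τ.im_pos
  have hgd : DifferentiableOn ℂ g (Metric.ball 0 1) :=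
    differentiableOn_cuspFunction_ball one_pos hf.per hf.1 hf.bdd
  have hgd' : DifferentiableOn ℂ (_root_.deriv g) (Metric.ball 0 1) := hgd.deriv Metric.isOpen_ball
  have hmem : Periodic.qParam 1 (τ : ℂ) ∈ Metric.ball (0 : ℂ) 1 := by simpa using hq
  have hs := Complex.hasSum_taylorSeries_on_ball hgd' hmem
  have hval : Derivative.normalizedDerivOfComplex f τ =
      Periodic.qParam 1 (τ : ℂ) * _root_.deriv g (Periodic.qParam 1 (τ : ℂ)) := by
    unfold Derivative.normalizedDerivOfComplex
    have he : (f ∘ ofComplex) =ᶠ[𝓝 (τ : ℂ)] fun w => g (Periodic.qParam 1 w) := by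
      filter_upwards [isOpen_upperHalfPlaneSet.mem_nhds τ.im_pos] with w hw
      have := eq_cuspFunction (h := 1) (⟨w, hw⟩ : ℍ) one_ne_zero hf.per
      simp only [comp_apply, ofComplex_apply_of_im_pos hw]
      exact this.symm
    rw [he.deriv_eq]
    have hq1 : HasDerivAt (fun w : ℂ => Periodic.qParam 1 w)
        (2 * π * Complex.I * Periodic.qParam 1 (τ : ℂ)) (τ : ℂ) := by
      have : HasDerivAt (fun w : ℂ => Complex.exp (2 * π * Complex.I * w))
        (Complex.exp (2 * π * Complex.I * τ) * (2 * π * Complex.I * 1)) (τ : ℂ) :=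
        ((hasDerivAt_id (τ : ℂ)).const_mul (2 * π * Complex.I)).cexp
      simp only [Periodic.qParam, Complex.ofReal_one, div_one]
      convert this using 1
      ring
    have hg1 : HasDerivAt g (_root_.deriv g (Periodic.qParam 1 (τ : ℂ))) (Periodic.qParam 1 (τ : ℂ)) :=
      (hgd.differentiableAt (Metric.isOpen_ball.mem_nhds hmem)).hasDerivAt
    have hcc : HasDerivAt (fun w => g (Periodic.qParam 1 w)) _ (τ : ℂ) := hg1.comp (τ : ℂ) hq1
    rw [hcc.deriv]
    have : (2 * π * Complex.I : ℂ) ≠ 0 := by simp [Real.pi_ne_zero]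
    field_simp
  rw [hval, ← hasSum_nat_add_iff' 1]
  have hs2 := hs.mul_left (Periodic.qParam 1 (τ : ℂ))
  have e1 : (fun n : ℕ => PowerSeries.coeff (n + 1) (thC s) • Periodic.qParam 1 (τ : ℂ) ^ (n + 1)) =
      fun n : ℕ => Periodic.qParam 1 (τ : ℂ) * ((n.factorial : ℂ)⁻¹ •
        (Periodic.qParam 1 (τ : ℂ) - 0) ^ n • iteratedDeriv n (_root_.deriv g) 0) := by
    funext n
    have hc := congrArg (PowerSeries.coeff (n + 1)) hf.qexp
    rw [qExpansion_coeff] at hc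
    have hn : ((n + 1).factorial : ℂ) = ((n : ℂ) + 1) * n.factorial := by
      push_cast [Nat.factorial_succ]; ring
    have hn0 : (n.factorial : ℂ) ≠ 0 := by exact_mod_cast n.factorial_ne_zero
    have hn1 : ((n : ℂ) + 1) ≠ 0 := by exact_mod_cast n.succ_ne_zero
    simp only [thC, PowerSeries.coeff_mk, ← hc, hn, iteratedDeriv_succ', sub_zero, smul_eq_mul, hg]
    push_cast
    field_simp
    ring
  have e2 : ∑ i ∈ Finset.range 1, PowerSeries.coeff i (thC s) • Periodic.qParam 1 (τ : ℂ) ^ i = 0 := by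
    simp [thC]
  rw [e1, e2]
  simpa only [sub_zero] using hs2

end Analytic

end RamId

namespace RamId

section Analytic2

open UpperHalfPlane Function ModularForm EisensteinSeries
open scoped Real MatrixGroups Topology Manifold

lemma vanish {k : ℕ} (hk : k < 12) {s : PowerSeries ℂ} {f : ℍ → ℂ} (h : Rep s f)
    (hinv : ∀ γ : SL(2, ℤ), f ∣[(k : ℤ)] γ = f) (h0 : PowerSeries.coeff 0 s = 0) : s = 0 := by
  let F : ModularForm 𝒮ℒ (k : ℤ) :=
    { toFun := f
      slash_action_eq' := by
        rintro _ ⟨γ, rfl⟩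
        exact hinv γ
      holo' := h.1
      bdd_at_cusps' := by
        intro c hc
        rw [Subgroup.IsArithmetic.isCusp_iff_isCusp_SL2Z] at hc
        rw [OnePoint.isBoundedAt_iff_forall_SL2Z hc]
        intro γ _
        have := hinv γ
        simp only [SL_slash] at this ⊢
        rw [this]
        exact h.bdd }
  have hF : qExpansion 1 F = s := h.qexp
  have hF0 : F = 0 := by
    apply ModularForm.sturm_bound_levelOne_nat
    rw [hF, Nat.div_eq_of_lt hk]
    by_contra hcon
    have : s.order = 0 := by simpa using hcon
    have h2 := PowerSeries.order_eq_nat (φ := s) (n := 0)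
    have h3 := h2.1 (by simpa using this)
    exact h3.1 h0
  have hf0 : f = 0 := by
    funext z
    exact congrArg (fun G : ModularForm 𝒮ℒ (k : ℤ) => G z) hF0
  rw [← h.qexp, hf0]
  exact qExpansion_zero 1

/-- complex Eisenstein q-expansions -/
def cE2 : PowerSeries ℂ := PowerSeries.mk fun n => if n = 0 then 1 else -24 * (ArithmeticFunction.sigma 1 n : ℂ)
/-- complex Eisenstein q-expansions -/
def cE4 : PowerSeries ℂ := PowerSeries.mk fun n => if n = 0 then 1 else 240 * (ArithmeticFunction.sigma 3 n : ℂ)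
/-- complex Eisenstein q-expansions -/
def cE6 : PowerSeries ℂ := PowerSeries.mk fun n => if n = 0 then 1 else -504 * (ArithmeticFunction.sigma 5 n : ℂ)

lemma rep_E2 : Rep cE2 E2 := by
  refine ⟨E2_mdifferentiable, fun τ => ?_⟩
  have := hasSum_qExpansion_E2 (z := τ)
  simpa only [Periodic.qParam, Complex.ofReal_one, div_one, cE2, PowerSeries.coeff_mk] using this

lemma rep_MF {k : ℤ} (f : ModularForm 𝒮ℒ k) : Rep (qExpansion 1 f) f :=
  rep_of (SlashInvariantFormClass.periodic_comp_ofComplex f one_mem_strictPeriods_SL) f.holo'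
    (ModularFormClass.bdd_at_infty f)

lemma b4 : bernoulli 4 = -1/30 := by
  rw [bernoulli_eq_bernoulli'_of_ne_one (by norm_num), bernoulli'_four]
lemma b6 : bernoulli 6 = 1/42 := by
  have h5 : bernoulli' 5 = 0 := by
    rw [bernoulli'_def]
    norm_num [Finset.sum_range_succ, Nat.choose, bernoulli'_two, bernoulli'_three, bernoulli'_four]
  rw [bernoulli_eq_bernoulli'_of_ne_one (by norm_num), bernoulli'_def]
  norm_num [Finset.sum_range_succ, Nat.choose, bernoulli'_two, bernoulli'_three, bernoulli'_four, h5]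

lemma rep_E4 : Rep cE4 E₄ := by
  have h := rep_MF E₄
  have : qExpansion 1 E₄ = cE4 := by
    ext m
    rw [E_qExpansion_coeff (by norm_num) (by decide)]
    simp only [cE4, PowerSeries.coeff_mk, b4]
    norm_num
  rwa [this] at h

lemma rep_E6 : Rep cE6 E₆ := by
  have h := rep_MF E₆
  have : qExpansion 1 E₆ = cE6 := by
    ext m
    rw [E_qExpansion_coeff (by norm_num) (by decide)]
    simp only [cE6, PowerSeries.coeff_mk, b6]
    norm_num
  rwa [this] at h

lemma inv_MF {k : ℤ} (f : ModularForm 𝒮ℒ k) (γ : SL(2, ℤ)) : (f : ℍ → ℂ) ∣[k] γ = f :=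
  f.slash_action_eq' _ ⟨γ, rfl⟩

lemma ram4 : thC cE4 = (1/3 : ℂ) • (cE2 * cE4 - cE6) := by
  have hr : Rep _ (Derivative.normalizedDerivOfComplex E₄ + (-(1/3) : ℂ) • (E2 * E₄) + (1/3 : ℂ) • (E₆ : ℍ → ℂ)) :=
    (rep_E4.deriv.add ((rep_E2.mul rep_E4).smul (-(1/3)))).add (rep_E6.smul (1/3))
  have := vanish (k := 6) (by norm_num) hr (fun γ => ?_) ?_
  · rw [← sub_eq_zero, ← this]
    module
  · have h1 := Derivative.serreDerivative_slash_invariant (k := 4) rep_E4.1 (γ := γ) (inv_MF E₄ γ)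
    have h2 := inv_MF E₆ γ
    have e : Derivative.normalizedDerivOfComplex E₄ + (-(1/3) : ℂ) • (E2 * E₄) =
      Derivative.serreDerivative ((4 : ℤ) : ℂ) E₄ := by
      funext z
      simp [Derivative.serreDerivative_apply]
      ring
    rw [e, SlashAction.add_slash, SL_smul_slash]
    congr 1
    exact congrArg (fun g => (1/3 : ℂ) • g) h2
  · simp [thC, cE2, cE4, cE6]

lemma ram6 : thC cE6 = (1/2 : ℂ) • (cE2 * cE6 - cE4 * cE4) := by
  have hr : Rep _ (Derivative.normalizedDerivOfComplex E₆ + (-(1/2) : ℂ) • (E2 * E₆) + (1/2 : ℂ) • ((E₄ : ℍ → ℂ) * E₄)) :=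
    (rep_E6.deriv.add ((rep_E2.mul rep_E6).smul (-(1/2)))).add ((rep_E4.mul rep_E4).smul (1/2))
  have := vanish (k := 8) (by norm_num) hr (fun γ => ?_) ?_
  · rw [← sub_eq_zero, ← this]
    module
  · have h1 := Derivative.serreDerivative_slash_invariant (k := 6) rep_E6.1 (γ := γ) (inv_MF E₆ γ)
    have h2 := mul_slash_SL2 4 4 γ E₄ E₄
    rw [show ((E₄ : ℍ → ℂ) ∣[(4 : ℤ)] γ) = E₄ from inv_MF E₄ γ] at h2
    have e : Derivative.normalizedDerivOfComplex E₆ + (-(1/2) : ℂ) • (E2 * E₆) =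
      Derivative.serreDerivative ((6 : ℤ) : ℂ) E₆ := by
      funext z
      simp [Derivative.serreDerivative_apply]
      ring
    rw [e, SlashAction.add_slash, SL_smul_slash]
    congr 1
    exact congrArg (fun g => (1/2 : ℂ) • g) h2
  · simp [thC, cE2, cE4, cE6]

lemma hasDeriv_inv_denom (γ : SL(2, ℤ)) (z : ℍ) :
    HasDerivAt ((fun z : ℍ => (denom γ z)⁻¹) ∘ ofComplex) (-(γ 1 0 : ℂ) / (denom γ z) ^ 2) (z : ℂ) := by
  have h := hasDerivAt_denom_zpow (γ : GL (Fin 2) ℝ) (-1) z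
  have he : ((fun z : ℍ => (denom γ z)⁻¹) ∘ ofComplex) =ᶠ[𝓝 (z : ℂ)]
      fun w => denom (γ : GL (Fin 2) ℝ) w ^ (-1 : ℤ) := by
    filter_upwards [isOpen_upperHalfPlaneSet.mem_nhds z.im_pos] with w hw
    simp [ofComplex_apply_of_im_pos hw]
  refine (h.congr_of_eventuallyEq he).congr_deriv ?_
  have : denom (γ : GL (Fin 2) ℝ) z ≠ 0 := denom_ne_zero _ z
  rw [show ((-1 : ℤ) - 1) = -2 by norm_num, zpow_neg]
  simp
  field_simp
  try norm_cast

lemma D_inv_denom (γ : SL(2, ℤ)) (z : ℍ) :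
    Derivative.normalizedDerivOfComplex (fun z : ℍ => (denom γ z)⁻¹) z =
      (2 * π * Complex.I)⁻¹ * (-(γ 1 0 : ℂ) / (denom γ z) ^ 2) := by
  unfold Derivative.normalizedDerivOfComplex
  rw [(hasDeriv_inv_denom γ z).deriv]

lemma ram2 : thC cE2 = (1/12 : ℂ) • (cE2 * cE2 - cE4) := by
  have hr : Rep _ (Derivative.normalizedDerivOfComplex E2 + (-(1/12) : ℂ) • (E2 * E2) + (1/12 : ℂ) • (E₄ : ℍ → ℂ)) :=
    (rep_E2.deriv.add ((rep_E2.mul rep_E2).smul (-(1/12)))).add (rep_E4.smul (1/12))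
  have := vanish (k := 4) (by norm_num) hr (fun γ => ?_) ?_
  · rw [← sub_eq_zero, ← this]
    module
  · have h1 := Derivative.normalizedDerivOfComplex_SL_slash (k := 2) rep_E2.1 (γ := γ)
    have h2 := inv_MF E₄ γ
    have h3 := mul_slash_SL2 2 2 γ E2 E2
    have hpi : (π : ℂ) ≠ 0 := by exact_mod_cast Real.pi_ne_zero
    have h4 : E2 ∣[(2 : ℤ)] γ = E2 + (12 * (2 * π * Complex.I)⁻¹ * (γ 1 0 : ℂ)) • fun z : ℍ => (denom γ z)⁻¹ := by
      rw [E2_slash_action]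
      funext z
      simp only [Pi.sub_apply, Pi.add_apply, Pi.smul_apply, D2, smul_eq_mul, riemannZeta_two]
      have : denom (γ : GL (Fin 2) ℝ) z ≠ 0 := denom_ne_zero _ z
      field_simp
      linear_combination (-(12 : ℂ) * γ 1 0) * Complex.I_sq
    have hm : MDiff (fun z : ℍ => (denom γ z)⁻¹) := by
      intro z
      exact mdifferentiableAt_iff.mpr (hasDeriv_inv_denom γ z).differentiableAt
    rw [h4, Derivative.normalizedDerivOfComplex_add _ _ rep_E2.1 (hm.const_smul _),
      Derivative.normalizedDerivOfComplex_smul _ _ hm] at h1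
    rw [h4] at h3
    rw [SlashAction.add_slash, SlashAction.add_slash, SL_smul_slash, SL_smul_slash]
    funext z
    have h1z := congrFun h1 z
    have h3z := congrFun h3 z
    have h2z : ((E₄ : ℍ → ℂ) ∣[((4 : ℕ) : ℤ)] γ) z = E₄ z := congrFun h2 z
    have h44 : ((2 : ℤ) + 2) = ((4 : ℕ) : ℤ) := by norm_num
    rw [h44] at h1z h3z
    simp only [Pi.add_apply, Pi.smul_apply, Pi.mul_apply, Pi.sub_apply, smul_eq_mul,
      D_inv_denom] at h1z h2z h3z ⊢
    rw [h3z, h2z]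
    have h5 := eq_add_of_sub_eq h1z.symm
    rw [h5]
    push_cast
    have : denom (γ : GL (Fin 2) ℝ) z ≠ 0 := denom_ne_zero _ z
    field_simp
    ring
  · simp [thC, cE2, cE4, cE6]

end Analytic2

end RamId

namespace RamId

/-- `q d/dq` as a derivation of `ℚ[[q]]`. -/
def th : Derivation ℚ (PowerSeries ℚ) (PowerSeries ℚ) := (PowerSeries.X : PowerSeries ℚ) • PowerSeries.derivative ℚ

lemma coeff_th (s : PowerSeries ℚ) (n : ℕ) :
    PowerSeries.coeff n (th s) = n * PowerSeries.coeff n s := by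
  simp only [th, Derivation.smul_apply, smul_eq_mul]
  cases n with
  | zero => simp
  | succ n => 
    rw [PowerSeries.coeff_succ_X_mul]
    simp [PowerSeries.coeff_derivative]
    ring

lemma sigma_cast (j n : ℕ) : ((sigmaQ j n : ℚ) : ℂ) = (ArithmeticFunction.sigma j n : ℂ) := by
  simp [sigmaQ, ArithmeticFunction.sigma_apply]

/-- coefficientwise inclusion. -/
abbrev toC : PowerSeries ℚ →+* PowerSeries ℂ := PowerSeries.map (algebraMap ℚ ℂ)

lemma toC_inj : Function.Injective toC := PowerSeries.map_injective _ (algebraMap ℚ ℂ).injective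

lemma toC_E2 : toC E2s = cE2 := by
  ext n; by_cases h : n = 0 <;> simp [E2s, cE2, h, sigma_cast]
lemma toC_E4 : toC E4s = cE4 := by
  ext n; by_cases h : n = 0 <;> simp [E4s, cE4, h, sigma_cast]
lemma toC_E6 : toC E6s = cE6 := by
  ext n; by_cases h : n = 0 <;> simp [E6s, cE6, h, sigma_cast]
lemma toC_th (s : PowerSeries ℚ) : toC (th s) = thC (toC s) := by
  ext n; simp [thC, coeff_th]
lemma toC_smul (c : ℚ) (s : PowerSeries ℚ) : toC (c • s) = (c : ℂ) • toC s := by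
  ext n; simp

lemma th_E2 : th E2s = (1/12 : ℚ) • (E2s ^ 2 - E4s) := by
  apply toC_inj
  rw [toC_th, toC_smul, map_sub, map_pow, toC_E2, toC_E4, ram2, sq]; norm_num
lemma th_E4 : th E4s = (1/3 : ℚ) • (E2s * E4s - E6s) := by
  apply toC_inj
  rw [toC_th, toC_smul, map_sub, map_mul, toC_E2, toC_E4, toC_E6, ram4]; norm_num
lemma th_E6 : th E6s = (1/2 : ℚ) • (E2s * E6s - E4s ^ 2) := by
  apply toC_inj
  rw [toC_th, toC_smul, map_sub, map_mul, map_pow, toC_E2, toC_E4, toC_E6, ram6, sq]; norm_num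

lemma Dop_add (f g : Poly3) : Dop (f + g) = Dop f + Dop g := by
  simp only [Dop, map_add]; ring
lemma Dop_mul (f g : Poly3) : Dop (f * g) = Dop f * g + f * Dop g := by
  simp only [Dop, Derivation.leibniz, smul_eq_mul]; ring
lemma Dop_C (c : ℚ) : Dop (C c) = 0 := by simp [Dop]
lemma Dop_X0 : Dop (X 0) = C (1/12 : ℚ) * (X 0 ^ 2 - X 1) := by
  simp [Dop, pderiv_X]
lemma Dop_X1 : Dop (X 1) = C (1/3 : ℚ) * (X 0 * X 1 - X 2) := by
  simp [Dop, pderiv_X]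
lemma Dop_X2 : Dop (X 2) = C (1/2 : ℚ) * (X 0 * X 2 - X 1 ^ 2) := by
  simp [Dop, pderiv_X]
lemma Dop_C_mul (c : ℚ) (f : Poly3) : Dop (C c * f) = C c * Dop f := by
  rw [Dop_mul, Dop_C]; ring

lemma Phi_X0 : Phi (X 0) = E2s := by simp [Phi]
lemma Phi_X1 : Phi (X 1) = E4s := by simp [Phi]
lemma Phi_X2 : Phi (X 2) = E6s := by simp [Phi]
lemma Phi_C (c : ℚ) : Phi (C c) = algebraMap ℚ _ c := by simp [Phi]

lemma Phi_Dop (f : Poly3) : Phi (Dop f) = th (Phi f) := by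
  induction f using MvPolynomial.induction_on with
  | C c => rw [Dop_C, Phi_C, map_zero, Derivation.map_algebraMap]
  | add f g hf hg => rw [Dop_add, map_add, map_add, map_add, hf, hg]
  | mul_X f i hf =>
    have hX : Phi (Dop (X i)) = th (Phi (X i)) := by
      fin_cases i
      · change Phi (Dop (X 0)) = th (Phi (X 0))
        rw [Dop_X0, Phi_X0, th_E2, map_mul, map_sub, map_pow, Phi_X0, Phi_X1, Phi_C, Algebra.smul_def]
      · change Phi (Dop (X 1)) = th (Phi (X 1))
        rw [Dop_X1, Phi_X1, th_E4, map_mul, map_sub, map_mul, Phi_X0, Phi_X1, Phi_X2, Phi_C, Algebra.smul_def]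
      · change Phi (Dop (X 2)) = th (Phi (X 2))
        rw [Dop_X2, Phi_X2, th_E6, map_mul, map_sub, map_mul, map_pow, Phi_X0, Phi_X1, Phi_X2, Phi_C, Algebra.smul_def]
    rw [Dop_mul, map_add, map_mul, map_mul, map_mul, Derivation.leibniz, hf, hX, smul_eq_mul, smul_eq_mul]
    ring

lemma Phi_Dop_iter (f : Poly3) (M n : ℕ) :
    PowerSeries.coeff n (Phi (Dop^[M] f)) = (n : ℚ) ^ M * PowerSeries.coeff n (Phi f) := by
  induction M generalizing f with
  | zero => simp
  | succ M ih => rw [Function.iterate_succ_apply, ih, Phi_Dop, coeff_th]; ring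

/-- The Euler operator for the weights 2, 4, 6. -/
def Eu (f : Poly3) : Poly3 := 2 * X 0 * pderiv 0 f + 4 * X 1 * pderiv 1 f + 6 * X 2 * pderiv 2 f

lemma pd_comm (i j : Fin 3) (f : Poly3) : pderiv i (pderiv j f) = pderiv j (pderiv i f) := by
  have : ⁅(pderiv i : Derivation ℚ Poly3 Poly3), (pderiv j : Derivation ℚ Poly3 Poly3)⁆ = 0 := by
    apply MvPolynomial.derivation_ext
    intro l
    rw [Derivation.commutator_apply]
    simp [pderiv_X, Pi.single_apply]
    split_ifs <;> simp
  have h := congrArg (fun d => d f) this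
  simp only [Derivation.commutator_apply, Derivation.zero_apply] at h
  exact sub_eq_zero.mp h

lemma pd_Dop (f : Poly3) : pderiv 0 (Dop f) = Dop (pderiv 0 f) + C (1/12 : ℚ) * Eu f := by
  have h12 : (C (1/12 : ℚ) : Poly3) * 12 = 1 := by
    rw [show (12 : Poly3) = C 12 from (map_ofNat C 12).symm, ← C_mul]; norm_num
  have e3 : (C (1/3 : ℚ) : Poly3) = C (1/12) * 4 := by
    rw [show (4 : Poly3) = C 4 from (map_ofNat C 4).symm, ← C_mul]; norm_num
  have e2 : (C (1/2 : ℚ) : Poly3) = C (1/12) * 6 := by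
    rw [show (6 : Poly3) = C 6 from (map_ofNat C 6).symm, ← C_mul]; norm_num
  have d4 : pderiv 0 (4 : Poly3) = 0 := by
    rw [show (4 : Poly3) = C 4 from (map_ofNat C 4).symm, pderiv_C]
  have d6 : pderiv 0 (6 : Poly3) = 0 := by
    rw [show (6 : Poly3) = C 6 from (map_ofNat C 6).symm, pderiv_C]
  simp only [Dop, Eu, map_add, Derivation.leibniz, smul_eq_mul, map_sub, Derivation.leibniz_pow,
    pderiv_C, pderiv_X, pd_comm 1 0 f, pd_comm 2 0 f, e2, e3]
  simp [d4, d6]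
  ring

end RamId

namespace RamId

lemma pInt_of_dvd {p : ℕ} {x : ℚ} {d : ℕ} (h : x.den ∣ d) (hd : ¬ p ∣ d) : pInt p x :=
  fun hh => hd (hh.trans h)

/-- The subring `ℤ_(p)` of `ℚ`. -/
def Zp (p : ℕ) (hp : p.Prime) : Subring ℚ where
  carrier := {x | pInt p x}
  mul_mem' {a b} ha hb := pInt_of_dvd (Rat.mul_den_dvd a b)
    (fun h => (hp.dvd_mul.mp h).elim ha hb)
  one_mem' := by simp [pInt, hp.one_lt.ne']
  add_mem' {a b} ha hb := pInt_of_dvd (Rat.add_den_dvd a b)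
    (fun h => (hp.dvd_mul.mp h).elim ha hb)
  zero_mem' := by simp [pInt, hp.one_lt.ne']
  neg_mem' {a} ha := by simpa [pInt] using ha

lemma mem_Zp {p : ℕ} {hp : p.Prime} {x : ℚ} : x ∈ Zp p hp ↔ pInt p x := Iff.rfl

lemma inv_mem_Zp {p : ℕ} (hp : p.Prime) {d : ℕ} (hd : ¬ p ∣ d) : ((d : ℚ))⁻¹ ∈ Zp p hp := by
  rw [mem_Zp]
  refine pInt_of_dvd (d := d) ?_ hd
  by_cases h0 : d = 0
  · subst h0; simp
  rw [Rat.inv_natCast_den_of_pos (Nat.pos_of_ne_zero h0)]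

/-- Polynomials with coefficients in `ℤ_(p)`. -/
def ZP (p : ℕ) (hp : p.Prime) : Subring Poly3 where
  carrier := {f | polyPInt p f}
  mul_mem' {a b} ha hb := fun m => by
    rw [coeff_mul]
    exact (Zp p hp).sum_mem fun x _ => (Zp p hp).mul_mem (ha _) (hb _)
  one_mem' := fun m => by
    rw [coeff_one]
    split_ifs
    · exact (Zp p hp).one_mem
    · exact (Zp p hp).zero_mem
  add_mem' {a b} ha hb := fun m => by
    rw [coeff_add]
    exact (Zp p hp).add_mem (ha _) (hb _)
  zero_mem' := fun m => by
    rw [coeff_zero]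
    exact (Zp p hp).zero_mem
  neg_mem' {a} ha := fun m => by
    rw [coeff_neg]
    exact (Zp p hp).neg_mem (ha _)

lemma mem_ZP {p : ℕ} {hp : p.Prime} {x : Poly3} : x ∈ ZP p hp ↔ polyPInt p x := Iff.rfl

lemma C_mem_ZP {p : ℕ} (hp : p.Prime) {c : ℚ} (hc : c ∈ Zp p hp) : (C c : Poly3) ∈ ZP p hp := by
  intro m
  rw [coeff_C]
  split_ifs
  · exact hc
  · exact (Zp p hp).zero_mem

lemma X_mem_ZP {p : ℕ} (hp : p.Prime) (i : Fin 3) : (X i : Poly3) ∈ ZP p hp := by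
  intro m
  rw [coeff_X]
  split_ifs
  · exact (Zp p hp).one_mem
  · exact (Zp p hp).zero_mem

lemma mono_mem_ZP {p : ℕ} (hp : p.Prime) (m : Fin 3 →₀ ℕ) {c : ℚ} (hc : c ∈ Zp p hp) :
    (monomial m c : Poly3) ∈ ZP p hp := by
  intro m
  rw [coeff_monomial]
  split_ifs
  · exact hc
  · exact (Zp p hp).zero_mem

lemma coeff_pd (i : Fin 3) (f : Poly3) (m : Fin 3 →₀ ℕ) :
    coeff m (pderiv i f) = (m i + 1) * coeff (m + Finsupp.single i 1) f := by
  rw [coeff_pderiv, mul_comm]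

lemma pd_mem_ZP {p : ℕ} (hp : p.Prime) (i : Fin 3) {f : Poly3} (hf : f ∈ ZP p hp) :
    pderiv i f ∈ ZP p hp := by
  intro m
  rw [coeff_pd]
  have := (Zp p hp).mul_mem (natCast_mem (Zp p hp) (m i + 1)) (hf (m + Finsupp.single i 1))
  push_cast at this
  exact this

lemma inv12_mem {p : ℕ} (hp : p.Prime) (hp5 : 5 ≤ p) (j : ℕ) : (1/12 : ℚ) ^ j ∈ Zp p hp := by
  apply pow_mem
  have := inv_mem_Zp hp (d := 12) (fun h => by
    have : p ∣ 2 ^ 2 * 3 := by simpa using h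
    rcases hp.dvd_mul.mp this with h | h
    · have := Nat.le_of_dvd (by norm_num) (hp.dvd_of_dvd_pow h); omega
    · have := Nat.le_of_dvd (by norm_num) h; omega)
  simpa using this

lemma Dop_mem_ZP {p : ℕ} (hp : p.Prime) (hp5 : 5 ≤ p) {f : Poly3} (hf : f ∈ ZP p hp) :
    Dop f ∈ ZP p hp := by
  have h12 : (1/12 : ℚ) ∈ Zp p hp := by simpa using inv12_mem hp hp5 1
  have h3 : (1/3 : ℚ) ∈ Zp p hp := by
    have := (Zp p hp).mul_mem h12 (natCast_mem (Zp p hp) 4)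
    norm_num at this ⊢; exact this
  have h2 : (1/2 : ℚ) ∈ Zp p hp := by
    have := (Zp p hp).mul_mem h12 (natCast_mem (Zp p hp) 6)
    norm_num at this ⊢; exact this
  unfold Dop
  have hX := X_mem_ZP hp
  refine add_mem (add_mem ?_ ?_) ?_
  · exact mul_mem (mul_mem (C_mem_ZP hp h12) (sub_mem (pow_mem (hX 0) 2) (hX 1))) (pd_mem_ZP hp 0 hf)
  · exact mul_mem (mul_mem (C_mem_ZP hp h3) (sub_mem (mul_mem (hX 0) (hX 1)) (hX 2))) (pd_mem_ZP hp 1 hf)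
  · exact mul_mem (mul_mem (C_mem_ZP hp h2) (sub_mem (mul_mem (hX 0) (hX 2)) (pow_mem (hX 1) 2))) (pd_mem_ZP hp 2 hf)

lemma Dop_iter_mem_ZP {p : ℕ} (hp : p.Prime) (hp5 : 5 ≤ p) {f : Poly3} (hf : f ∈ ZP p hp) (M : ℕ) :
    Dop^[M] f ∈ ZP p hp := by
  induction M with
  | zero => simpa
  | succ M ih => rw [Function.iterate_succ_apply']; exact Dop_mem_ZP hp hp5 ih

/-! Isobaric polynomials. -/

lemma iso_iff {w : ℕ} {f : Poly3} : Isobaric w f ↔ IsWeightedHomogeneous (![2,4,6] : Fin 3 → ℕ) f w := by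
  unfold Isobaric IsWeightedHomogeneous
  simp only [mem_support_iff]
  refine forall_congr' fun m => forall_congr' fun _ => ?_
  rw [Finsupp.weight_apply, Finsupp.sum_fintype _ _ (by simp)]
  simp [Fin.sum_univ_three]
  constructor <;> intro h <;> linarith

lemma iso_add {w : ℕ} {f g : Poly3} (hf : Isobaric w f) (hg : Isobaric w g) : Isobaric w (f + g) := by
  rw [iso_iff] at *; exact hf.add hg
lemma iso_mul {w v : ℕ} {f g : Poly3} (hf : Isobaric w f) (hg : Isobaric v g) :
    Isobaric (w + v) (f * g) := by
  rw [iso_iff] at *; exact hf.mul hg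
lemma iso_pow {w : ℕ} {f : Poly3} (hf : Isobaric w f) (n : ℕ) : Isobaric (n * w) (f ^ n) := by
  rw [iso_iff] at *; simpa using hf.pow n
lemma iso_C (c : ℚ) : Isobaric 0 (C c) := by
  rw [iso_iff]; exact isWeightedHomogeneous_C _ c
lemma iso_X0 : Isobaric 2 (X 0) := by
  rw [iso_iff]; exact isWeightedHomogeneous_X ℚ (![2,4,6] : Fin 3 → ℕ) 0
lemma iso_X1 : Isobaric 4 (X 1) := by
  rw [iso_iff]; exact isWeightedHomogeneous_X ℚ (![2,4,6] : Fin 3 → ℕ) 1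
lemma iso_X2 : Isobaric 6 (X 2) := by
  rw [iso_iff]; exact isWeightedHomogeneous_X ℚ (![2,4,6] : Fin 3 → ℕ) 2
lemma iso_Cmul {w : ℕ} (c : ℚ) {f : Poly3} (hf : Isobaric w f) : Isobaric w (C c * f) := by
  simpa using iso_mul (iso_C c) hf
lemma iso_sub {w : ℕ} {f g : Poly3} (hf : Isobaric w f) (hg : Isobaric w g) : Isobaric w (f - g) := by
  have := iso_add hf (iso_Cmul (-1) hg)
  simpa [sub_eq_add_neg] using this
lemma iso_sum {ι : Type*} {w : ℕ} (s : Finset ι) (f : ι → Poly3) (h : ∀ i ∈ s, Isobaric w (f i)) :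
    Isobaric w (∑ i ∈ s, f i) := by
  rw [iso_iff]
  exact IsWeightedHomogeneous.sum s f w fun i hi => iso_iff.mp (h i hi)

lemma iso_of_coeff {w : ℕ} {f : Poly3} :
    Isobaric w f ↔ ∀ m, coeff m f ≠ 0 → 2 * m 0 + 4 * m 1 + 6 * m 2 = w := by
  simp [Isobaric, mem_support_iff]
lemma noP_of_coeff {f : Poly3} : NoP f ↔ ∀ m, coeff m f ≠ 0 → m 0 = 0 := by
  simp [NoP, mem_support_iff]

lemma Dop_monomial_iso (m : Fin 3 →₀ ℕ) (c : ℚ) {w : ℕ} (h : 2 * m 0 + 4 * m 1 + 6 * m 2 = w) :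
    Isobaric (w + 2) (Dop (monomial m c)) := by
  have key : ∀ a b d : ℕ, Isobaric (2 * a + 4 * b + 6 * d + 2) (Dop (X 0 ^ a * X 1 ^ b * X 2 ^ d)) := by
    have hpow : ∀ (f : Poly3) (v : ℕ), Isobaric v f → Isobaric (v + 2) (Dop f) → ∀ a : ℕ,
        Isobaric (a * v + 2) (Dop (f ^ a)) := by
      intro f v hf hD a
      induction a with
      | zero => 
        have : Dop ((f : Poly3) ^ 0) = 0 := by rw [pow_zero, ← C_1, Dop_C]
        rw [this]; intro m hm; simp at hm
      | succ a ih =>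
        rw [pow_succ, Dop_mul]
        have h1 := iso_mul ih hf
        have h2 := iso_mul (iso_pow hf a) hD
        have e1 : a * v + 2 + v = (a + 1) * v + 2 := by ring
        have e2 : a * v + (v + 2) = (a + 1) * v + 2 := by ring
        rw [e1] at h1; rw [e2] at h2
        exact iso_add h1 h2
    have hD0 : Isobaric (2 + 2) (Dop (X 0)) := by
      rw [Dop_X0]; exact iso_Cmul _ (iso_sub (iso_pow iso_X0 2) iso_X1)
    have hD1 : Isobaric (4 + 2) (Dop (X 1)) := by
      rw [Dop_X1]; exact iso_Cmul _ (iso_sub (w := 6) (iso_mul (w := 2) (v := 4) iso_X0 iso_X1) iso_X2)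
    have hD2 : Isobaric (6 + 2) (Dop (X 2)) := by
      rw [Dop_X2]; exact iso_Cmul _ (iso_sub (w := 8) (iso_mul (w := 2) (v := 6) iso_X0 iso_X2) (iso_pow iso_X1 2))
    intro a b d
    rw [Dop_mul, Dop_mul]
    have ia := iso_pow iso_X0 a
    have ib := iso_pow iso_X1 b
    have id := iso_pow iso_X2 d
    have da := hpow _ _ iso_X0 hD0 a
    have db := hpow _ _ iso_X1 hD1 b
    have dd := hpow _ _ iso_X2 hD2 d
    have e1 := iso_mul (iso_add (w := a * 2 + b * 4 + 2)
      (by convert iso_mul da ib using 1; ring) (by convert iso_mul ia db using 1; ring)) id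
    have e2 := iso_mul (iso_mul ia ib) dd
    refine iso_add ?_ ?_
    · convert e1 using 1; ring
    · convert e2 using 1; ring
  have e : (monomial m c : Poly3) = C c * (X 0 ^ m 0 * X 1 ^ m 1 * X 2 ^ m 2) := by
    rw [monomial_eq, Finsupp.prod_fintype _ _ (by simp), Fin.prod_univ_three]
  rw [e, Dop_C_mul, ← h]
  exact iso_Cmul _ (key _ _ _)

lemma Dop_zero : Dop 0 = 0 := by simp [Dop]

lemma Dop_sum {ι : Type*} (s : Finset ι) (f : ι → Poly3) : Dop (∑ i ∈ s, f i) = ∑ i ∈ s, Dop (f i) := by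
  classical
  induction s using Finset.induction_on with
  | empty => simp [Dop_zero]
  | insert a s ha ih => rw [Finset.sum_insert ha, Finset.sum_insert ha, Dop_add, ih]

lemma Dop_iso {w : ℕ} {f : Poly3} (hf : Isobaric w f) : Isobaric (w + 2) (Dop f) := by
  rw [f.as_sum, Dop_sum]
  exact iso_sum _ _ fun m hm => Dop_monomial_iso m _ (hf m hm)

lemma Dop_iter_iso {w : ℕ} {f : Poly3} (hf : Isobaric w f) (M : ℕ) :
    Isobaric (w + 2 * M) (Dop^[M] f) := by
  induction M with
  | zero => simpa
  | succ M ih =>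
    rw [Function.iterate_succ_apply']
    exact Dop_iso ih

lemma coeff_Eu (f : Poly3) (m : Fin 3 →₀ ℕ) :
    coeff m (Eu f) = ((2 * m 0 + 4 * m 1 + 6 * m 2 : ℕ) : ℚ) * coeff m f := by
  induction f using MvPolynomial.induction_on' with
  | monomial u a =>
    have hx : ∀ i : Fin 3, X i * pderiv i (monomial u a : Poly3) = C (u i : ℚ) * monomial u a := by
      intro i
      rw [pderiv_monomial, X, monomial_mul, C_mul_monomial, one_mul]
      by_cases h : u i = 0
      · simp [h]
      · have hu : Finsupp.single i 1 + (u - Finsupp.single i 1) = u :=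
          add_tsub_cancel_of_le (Finsupp.single_le_iff.mpr (Nat.pos_of_ne_zero h))
        rw [hu, mul_comm]
    have : Eu (monomial u a) = C ((2 * u 0 + 4 * u 1 + 6 * u 2 : ℕ) : ℚ) * monomial u a := by
      have e := hx 0; have e1 := hx 1; have e2 := hx 2
      unfold Eu
      rw [mul_assoc, mul_assoc, mul_assoc, e, e1, e2]
      simp only [Nat.cast_add, Nat.cast_mul, C_add, C_mul, Nat.cast_ofNat, map_ofNat]
      ring
    rw [this, coeff_C_mul, coeff_monomial]
    split_ifs with h
    · subst h; rfl
    · simp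
  | add f g hf hg =>
    have : Eu (f + g) = Eu f + Eu g := by simp only [Eu, map_add]; ring
    rw [this, coeff_add, coeff_add, hf, hg]; ring

lemma Eu_iso {w : ℕ} {f : Poly3} (hf : Isobaric w f) : Eu f = C (w : ℚ) * f := by
  ext m
  rw [coeff_Eu, coeff_C_mul]
  by_cases h : coeff m f = 0
  · simp [h]
  · rw [iso_of_coeff.mp hf m h]

end RamId

namespace RamId

lemma pd_Dop_iter {k : ℕ} {F : Poly3} (hF : Isobaric k F) (hP : NoP F) (M : ℕ) :
    pderiv 0 (Dop^[M + 1] F) = C (((M : ℚ) + 1) * (k + M) / 12) * Dop^[M] F := by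
  have h0 : pderiv 0 F = 0 := by
    ext m
    rw [coeff_pd, coeff_zero]
    by_cases h : coeff (m + Finsupp.single 0 1) F = 0
    · rw [h, mul_zero]
    · have := noP_of_coeff.mp hP _ h
      simp at this
  induction M with
  | zero =>
    rw [Function.iterate_succ_apply', pd_Dop, Function.iterate_zero, id, h0, Dop_zero, Eu_iso hF,
      ← mul_assoc, ← C_mul, zero_add]
    congr 2
    push_cast; ring
  | succ M ih =>
    rw [Function.iterate_succ_apply', pd_Dop, ih, Dop_C_mul, Eu_iso (Dop_iter_iso hF (M + 1)),
      ← Function.iterate_succ_apply' Dop M F, ← mul_assoc, ← C_mul, ← add_mul, ← C_add]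
    congr 2
    push_cast; ring

lemma coeff_Dop_iter {k : ℕ} {F : Poly3} (hF : Isobaric (k + 1) F) (hP : NoP F) (m : Fin 3 →₀ ℕ)
    (hm : m 0 = 0) (j M : ℕ) :
    coeff (m + Finsupp.single 0 j) (Dop^[M] F) =
      (M.choose j : ℚ) * ((k + M).descFactorial j : ℚ) * (1/12) ^ j * coeff m (Dop^[M - j] F) := by
  induction j generalizing M with
  | zero => simp
  | succ j ih =>
    cases M with
    | zero =>
      simp only [Nat.choose_zero_succ, Nat.cast_zero, zero_mul, Function.iterate_zero, id]
      by_contra h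
      have := noP_of_coeff.mp hP _ h
      simp at this
    | succ M =>
      have h1 := coeff_pd 0 (Dop^[M + 1] F) (m + Finsupp.single 0 j)
      rw [pd_Dop_iter hF hP, coeff_C_mul, ih M, add_assoc, ← Finsupp.single_add] at h1
      have h2 : ((M : ℚ) + 1) * M.choose j = (M + 1).choose (j + 1) * (j + 1) := by
        exact_mod_cast Nat.add_one_mul_choose_eq M j
      have h3 : ((k + (M + 1)).descFactorial (j + 1) : ℚ) = (k + M + 1) * (k + M).descFactorial j := by
        rw [← add_assoc, Nat.succ_descFactorial_succ]; push_cast; ring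
      rw [Finsupp.add_apply, hm, Finsupp.single_eq_same, zero_add] at h1
      have hj : ((j : ℚ) + 1) ≠ 0 := by positivity
      apply mul_left_cancel₀ hj
      rw [← h1, h3, Nat.add_sub_add_right]
      push_cast
      linear_combination (((k:ℚ) + M + 1) * (k + M).descFactorial j * (1/12) ^ (j+1) * coeff m (Dop^[M - j] F)) * h2

/-- The part of `f` not involving `P`. -/
def pf (f : Poly3) : Poly3 := ∑ m ∈ f.support with m 0 = 0, monomial m (coeff m f)

lemma coeff_pf (f : Poly3) (m : Fin 3 →₀ ℕ) : coeff m (pf f) = if m 0 = 0 then coeff m f else 0 := by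
  classical
  simp only [pf, coeff_sum, coeff_monomial]
  rw [Finset.sum_ite_eq' ]
  by_cases h : m 0 = 0
  · by_cases h2 : coeff m f = 0 <;> simp [h, h2]
  · simp [h]

lemma pf_noP (f : Poly3) : NoP (pf f) := by
  rw [noP_of_coeff]
  intro m hm
  rw [coeff_pf] at hm
  by_contra h
  simp [h] at hm

lemma pf_iso {w : ℕ} {f : Poly3} (hf : Isobaric w f) : Isobaric w (pf f) := by
  rw [iso_of_coeff] at *
  intro m hm
  apply hf m
  rw [coeff_pf] at hm
  split_ifs at hm with h
  · exact hm
  · exact absurd rfl hm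

lemma pf_mem {p : ℕ} (hp : p.Prime) {f : Poly3} (hf : f ∈ ZP p hp) : pf f ∈ ZP p hp := by
  intro m
  rw [coeff_pf]
  split_ifs
  · exact hf m
  · exact (Zp p hp).zero_mem

lemma dvd_key (N M j : ℕ) (hj : j ≠ 0) : M ∣ M.choose j * N.descFactorial j := by
  rw [Nat.descFactorial_eq_factorial_mul_choose, ← mul_assoc, mul_comm (M.choose j),
    ← Nat.descFactorial_eq_factorial_mul_choose]
  apply Dvd.dvd.mul_right
  obtain ⟨j, rfl⟩ := Nat.exists_eq_succ_of_ne_zero hj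
  cases M with
  | zero => simp
  | succ M => rw [Nat.succ_descFactorial_succ]; exact Dvd.intro _ rfl

lemma split_m (m : Fin 3 →₀ ℕ) : ∃ m' : Fin 3 →₀ ℕ, m' 0 = 0 ∧ m = m' + Finsupp.single 0 (m 0) := by
  refine ⟨m.erase 0, by simp, ?_⟩
  rw [Finsupp.erase_add_single]

/-- `D^M F = G + M T` with `G` free of `P`. -/
lemma decomp {p : ℕ} (hp : p.Prime) (hp5 : 5 ≤ p) {k : ℕ} {F : Poly3} (hF : Isobaric (k + 1) F)
    (hP : NoP F) (hI : F ∈ ZP p hp) (M : ℕ) (hM : M ≠ 0) :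
    ∃ T ∈ ZP p hp, Dop^[M] F = pf (Dop^[M] F) + C (M : ℚ) * T ∧ Isobaric (k + 1 + 2 * M) T ∧
      ∀ m, coeff m T ≠ 0 → m 0 ≤ M := by
  have hM' : (M : ℚ) ≠ 0 := by exact_mod_cast hM
  have hiso := Dop_iter_iso hF M
  refine ⟨C (1/(M:ℚ)) * (Dop^[M] F - pf (Dop^[M] F)), ?_, ?_, ?_, ?_⟩
  · intro m
    rw [coeff_C_mul, coeff_sub, coeff_pf]
    split_ifs with h
    · rw [sub_self, mul_zero]; exact (Zp p hp).zero_mem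
    · obtain ⟨m', hm', e⟩ := split_m m
      obtain ⟨c, hc⟩ := dvd_key (k + M) M (m 0) h
      rw [e, coeff_Dop_iter hF hP m' hm', sub_zero]
      have hc' : (M.choose (m 0) : ℚ) * ((k + M).descFactorial (m 0) : ℚ) = M * c := by exact_mod_cast hc
      rw [hc']
      have : 1 / (M : ℚ) * (M * c * (1 / 12) ^ (m 0) * coeff m' (Dop^[M - m 0] F)) =
        c * (1 / 12) ^ (m 0) * coeff m' (Dop^[M - m 0] F) := by field_simp
      rw [this]
      exact (Zp p hp).mul_mem ((Zp p hp).mul_mem (natCast_mem _ c) (inv12_mem hp hp5 _))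
        (Dop_iter_mem_ZP hp hp5 hI _ m')
  · rw [← mul_assoc, ← C_mul, mul_one_div_cancel hM', C_1, one_mul]; ring
  · exact iso_Cmul _ (iso_sub hiso (pf_iso hiso))
  · intro m hm
    by_contra hlt
    apply hm
    obtain ⟨m', hm', e⟩ := split_m m
    rw [coeff_C_mul, coeff_sub, coeff_pf, if_neg (by omega)]
    rw [e, coeff_Dop_iter hF hP m' hm', Nat.choose_eq_zero_of_lt (by omega)]
    simp

end RamId

namespace RamId

/-- Power series with coefficients in `ℤ_(p)`. -/
def IS (p : ℕ) (hp : p.Prime) : Subring (PowerSeries ℚ) where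
  carrier := {f | ∀ n, PowerSeries.coeff n f ∈ Zp p hp}
  mul_mem' {a b} ha hb := fun m => by
    rw [PowerSeries.coeff_mul]
    exact (Zp p hp).sum_mem fun x _ => (Zp p hp).mul_mem (ha _) (hb _)
  one_mem' := fun m => by
    rw [PowerSeries.coeff_one]
    split_ifs
    · exact (Zp p hp).one_mem
    · exact (Zp p hp).zero_mem
  add_mem' {a b} ha hb := fun m => by
    rw [map_add]
    exact (Zp p hp).add_mem (ha _) (hb _)
  zero_mem' := fun m => by
    rw [map_zero]
    exact (Zp p hp).zero_mem
  neg_mem' {a} ha := fun m => by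
    rw [map_neg]
    exact (Zp p hp).neg_mem (ha _)

variable {p : ℕ} (hp : p.Prime)

lemma sigma_mem (j n : ℕ) : sigmaQ j n ∈ Zp p hp :=
  (Zp p hp).sum_mem fun d _ => pow_mem (natCast_mem _ d) j

lemma E2s_mem : E2s ∈ IS p hp := by
  intro n
  simp only [E2s, PowerSeries.coeff_mk]
  split_ifs
  · exact one_mem _
  · exact mul_mem (by simpa using intCast_mem (Zp p hp) (-24)) (sigma_mem hp _ _)

lemma E4s_mem : E4s ∈ IS p hp := by
  intro n
  simp only [E4s, PowerSeries.coeff_mk]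
  split_ifs
  · exact one_mem _
  · exact mul_mem (by simpa using intCast_mem (Zp p hp) (240)) (sigma_mem hp _ _)

lemma E6s_mem : E6s ∈ IS p hp := by
  intro n
  simp only [E6s, PowerSeries.coeff_mk]
  split_ifs
  · exact one_mem _
  · exact mul_mem (by simpa using intCast_mem (Zp p hp) (-504)) (sigma_mem hp _ _)

lemma algMap_mem {c : ℚ} (hc : c ∈ Zp p hp) : algebraMap ℚ (PowerSeries ℚ) c ∈ IS p hp := by
  intro n
  rw [PowerSeries.algebraMap_apply, Algebra.algebraMap_self_apply, PowerSeries.coeff_C]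
  split_ifs
  · exact hc
  · exact zero_mem _

lemma Phi_eq (f : Poly3) : Phi f =
    ∑ m ∈ f.support, algebraMap ℚ _ (coeff m f) * (E2s ^ m 0 * E4s ^ m 1 * E6s ^ m 2) := by
  rw [Phi, aeval_def, eval₂_eq']
  simp [Fin.prod_univ_three]

lemma Phi_mem {f : Poly3} (hf : f ∈ ZP p hp) : Phi f ∈ IS p hp := by
  rw [Phi_eq]
  exact sum_mem fun m _ => mul_mem (algMap_mem hp (hf m)) (mul_mem (mul_mem (pow_mem (E2s_mem hp) _)
    (pow_mem (E4s_mem hp) _)) (pow_mem (E6s_mem hp) _))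

/-- `s` is divisible by `p ^ e` in `ℤ_(p)[[q]]`. -/
def Dv (e : ℕ) (s : PowerSeries ℚ) : Prop := ∃ u ∈ IS p hp, s = (p : PowerSeries ℚ) ^ e * u

lemma Dv.add {e : ℕ} {s t : PowerSeries ℚ} (hs : Dv hp e s) (ht : Dv hp e t) : Dv hp e (s + t) := by
  obtain ⟨u, hu, rfl⟩ := hs
  obtain ⟨v, hv, rfl⟩ := ht
  exact ⟨u + v, add_mem hu hv, by ring⟩

lemma Dv.mul {e : ℕ} {s t : PowerSeries ℚ} (hs : Dv hp e s) (ht : t ∈ IS p hp) : Dv hp e (s * t) := by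
  obtain ⟨u, hu, rfl⟩ := hs
  exact ⟨u * t, mul_mem hu ht, by ring⟩

lemma Dv.neg {e : ℕ} {s : PowerSeries ℚ} (hs : Dv hp e s) : Dv hp e (-s) := by
  obtain ⟨u, hu, rfl⟩ := hs
  exact ⟨-u, neg_mem hu, by ring⟩

lemma Dv.sub {e : ℕ} {s t : PowerSeries ℚ} (hs : Dv hp e s) (ht : Dv hp e t) : Dv hp e (s - t) := by
  rw [sub_eq_add_neg]; exact hs.add hp (ht.neg hp)

lemma Dv.sum {ι : Type*} {e : ℕ} (s : Finset ι) (f : ι → PowerSeries ℚ) (h : ∀ i ∈ s, Dv hp e (f i)) :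
    Dv hp e (∑ i ∈ s, f i) := by
  classical
  induction s using Finset.induction_on with
  | empty => exact ⟨0, zero_mem _, by simp⟩
  | insert a s ha ih =>
    rw [Finset.sum_insert ha]
    exact (h a (by simp)).add hp (ih fun i hi => h i (by simp [hi]))

lemma Dv.mono {e e' : ℕ} (h : e' ≤ e) {s : PowerSeries ℚ} (hs : Dv hp e s) : Dv hp e' s := by
  obtain ⟨u, hu, rfl⟩ := hs
  refine ⟨(p : PowerSeries ℚ) ^ (e - e') * u, mul_mem (pow_mem (natCast_mem _ p) _) hu, ?_⟩
  rw [← mul_assoc, ← pow_add]; congr 2; omega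

lemma p_ne {p : ℕ} (hp : p.Prime) : (p : PowerSeries ℚ) ≠ 0 := by
  intro h
  have h2 := congrArg (PowerSeries.constantCoeff (R := ℚ)) h
  rw [map_natCast, map_zero] at h2
  exact hp.ne_zero (by exact_mod_cast h2)

lemma Dv.cancel {e : ℕ} {s : PowerSeries ℚ} (hs : Dv hp (e + 1) ((p : PowerSeries ℚ) * s)) : Dv hp e s := by
  obtain ⟨u, hu, h⟩ := hs
  refine ⟨u, hu, mul_left_cancel₀ (p_ne hp) ?_⟩
  rw [h]; ring

lemma Dv_of_coeff {e : ℕ} {s : PowerSeries ℚ} (h : ∀ n, ∃ c ∈ Zp p hp, PowerSeries.coeff n s = (p : ℚ) ^ e * c) :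
    Dv hp e s := by
  choose c hc h using h
  refine ⟨PowerSeries.mk c, fun n => by simpa using hc n, ?_⟩
  ext n
  have : (p : PowerSeries ℚ) ^ e = PowerSeries.C ((p : ℚ) ^ e) := by simp
  rw [this, PowerSeries.coeff_C_mul, h, PowerSeries.coeff_mk]

/-- `x ≡ y` implies `x^n ≡ y^n`. -/
lemma Dv.pow_sub {e : ℕ} {s t : PowerSeries ℚ} (h : Dv hp e (s - t)) (hs : s ∈ IS p hp) (ht : t ∈ IS p hp)
    (n : ℕ) : Dv hp e (s ^ n - t ^ n) := by
  rw [← Commute.mul_geom_sum₂ (Commute.all s t)]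
  exact h.mul hp (sum_mem fun i _ => mul_mem (pow_mem hs _) (pow_mem ht _))

lemma Dv.mul_sub {e : ℕ} {s t s' t' : PowerSeries ℚ} (h : Dv hp e (s - t)) (h' : Dv hp e (s' - t'))
    (hs : s' ∈ IS p hp) (ht : t ∈ IS p hp) : Dv hp e (s * s' - t * t') := by
  have e : s * s' - t * t' = (s - t) * s' + (s' - t') * t := by ring
  rw [e]
  exact (h.mul hp hs).add hp (h'.mul hp ht)

lemma Dv.pow_p {s : PowerSeries ℚ} (h : Dv hp 1 (s - 1)) (hs : s ∈ IS p hp) (n : ℕ) :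
    Dv hp 2 (s ^ (n * p) - 1) := by
  have key : Dv hp 2 (s ^ p - 1) := by
    obtain ⟨u, hu, h⟩ := h
    have hd : (p : IS p hp) ∣ (⟨s, hs⟩ : IS p hp) - 1 := by
      refine ⟨⟨u, hu⟩, Subtype.ext ?_⟩
      simpa using h
    obtain ⟨v, hv⟩ := dvd_sub_pow_of_dvd_sub hd 1
    have hv' := congrArg Subtype.val hv
    refine ⟨v, v.2, ?_⟩
    simpa using hv'
  have := key.pow_sub hp (pow_mem hs p) (one_mem _) n
  rwa [one_pow, ← pow_mul, mul_comm] at this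

lemma pow_congr_int (n : ℕ) : ∃ c ∈ Zp p hp, (n : ℚ) ^ (p ^ 2) - (n : ℚ) ^ p = (p : ℚ) ^ 2 * c := by
  haveI := Fact.mk hp
  have h1 : (p : ℤ) ∣ (n : ℤ) ^ p - n := by
    rw [← ZMod.intCast_zmod_eq_zero_iff_dvd]
    push_cast
    rw [ZMod.pow_card, sub_self]
  obtain ⟨c, hc⟩ := dvd_sub_pow_of_dvd_sub h1 1
  refine ⟨c, intCast_mem _ c, ?_⟩
  have : ((n : ℤ) ^ p) ^ p ^ 1 - (n : ℤ) ^ p ^ 1 = n ^ (p ^ 2) - n ^ p := by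
    rw [← pow_mul]; ring_nf
  rw [this] at hc
  exact_mod_cast hc

lemma theta_congr {F : Poly3} (hF : F ∈ ZP p hp) :
    Dv hp 2 (Phi (Dop^[p ^ 2] F) - Phi (Dop^[p] F)) := by
  apply Dv_of_coeff
  intro n
  obtain ⟨c, hc, h⟩ := pow_congr_int hp n
  refine ⟨c * PowerSeries.coeff n (Phi F), mul_mem hc (Phi_mem hp hF n), ?_⟩
  rw [map_sub, Phi_Dop_iter, Phi_Dop_iter, ← sub_mul, h]; ring

lemma unit_mem {z : ℚ} (hz : z ∈ Zp p hp) : (-1 + p * z)⁻¹ ∈ Zp p hp ∧ -1 + p * z ≠ 0 := by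
  have hnd : ¬ (p : ℤ) ∣ (p * z.num - z.den) := by
    intro h
    have : (p : ℤ) ∣ z.den := by
      have h2 := dvd_sub (Dvd.intro z.num rfl : (p : ℤ) ∣ p * z.num) h
      simpa using h2
    exact hz (by exact_mod_cast this)
  have e : -1 + p * z = ((p * z.num - z.den : ℤ) : ℚ) / z.den := by
    have hd : (z.den : ℚ) ≠ 0 := by exact_mod_cast z.den_ne_zero
    push_cast
    rw [eq_div_iff hd, add_mul, mul_assoc, Rat.mul_den_eq_num]; ring
  rw [e]
  set d : ℤ := p * z.num - z.den with hdd
  have hd0 : d ≠ 0 := fun h => hnd (by rw [h]; exact dvd_zero _)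
  refine ⟨?_, div_ne_zero (by exact_mod_cast hd0) (by exact_mod_cast z.den_ne_zero)⟩
  rw [inv_div, div_eq_mul_inv]
  refine mul_mem (natCast_mem _ _) ?_
  have h3 := inv_mem_Zp hp (d := d.natAbs) (fun h => hnd (by rwa [Int.natCast_dvd]))
  rcases Int.natAbs_eq d with h | h
  · rw [h]; simpa using h3
  · rw [h]; push_cast; rw [inv_neg]; simpa using neg_mem h3

lemma EAs_congr (hp5 : 5 ≤ p) : Dv hp 1 (EAs p - 1) := by
  have hodd : 2 * ((p - 1) / 2) = p - 1 := by
    rcases hp.eq_two_or_odd with h | h <;> omega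
  obtain ⟨N, hN⟩ := Bernoulli.vonStaudt_clausen ((p - 1) / 2)
  rw [hodd] at hN
  set S := (Finset.range (p - 1 + 2)).filter (fun q => q.Prime ∧ (q - 1) ∣ p - 1) with hS
  have hpS : p ∈ S := by simp [hS, hp]; omega
  rw [← Finset.add_sum_erase _ _ hpS] at hN
  set z := (N : ℚ) - ∑ q ∈ S.erase p, (1 : ℚ) / q with hz
  have hzm : z ∈ Zp p hp := by
    refine sub_mem (intCast_mem _ _) (sum_mem fun q hq => ?_)
    rw [one_div]
    apply inv_mem_Zp hp
    intro hd
    have hq' : q.Prime := by simp [hS] at hq; exact hq.2.2.1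
    have := (Nat.prime_dvd_prime_iff_eq hp hq').mp hd
    exact (Finset.mem_erase.mp hq).1 this.symm
  have hp0 : (p : ℚ) ≠ 0 := by exact_mod_cast hp.ne_zero
  have hB : bernoulli (p - 1) = (-1 + p * z) / p := by
    have : bernoulli (p - 1) = z - 1 / p := by rw [hz, hN]; ring
    rw [this]; field_simp; ring
  apply Dv_of_coeff
  intro n
  obtain ⟨h1, h2⟩ := unit_mem hp hzm
  by_cases hn : n = 0
  · refine ⟨0, zero_mem _, ?_⟩
    simp [EAs, hn]
  · refine ⟨-(2 * ((p : ℚ) - 1)) * (-1 + p * z)⁻¹ * sigmaQ (p - 2) n, ?_, ?_⟩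
    · refine mul_mem (mul_mem ?_ h1) (sigma_mem hp _ _)
      have := intCast_mem (Zp p hp) (-(2 * (p - 1)))
      simpa using this
    · simp only [EAs, map_sub, PowerSeries.coeff_mk, if_neg hn, PowerSeries.coeff_one, hB]
      field_simp
      ring

end RamId

namespace RamId

variable {p : ℕ} (hp : p.Prime)

lemma den_ne {p : ℕ} (hp : p.Prime) {x : ℚ} (hx : x ∈ Zp p hp) : (x.den : ZMod p) ≠ 0 := by
  rw [Ne, ZMod.natCast_eq_zero_iff]; exact hx

/-- Reduction mod `p` on `ℤ_(p)`. -/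
def red [Fact p.Prime] : Zp p hp →+* ZMod p where
  toFun x := ((x : ℚ) : ZMod p)
  map_one' := by simp
  map_zero' := by simp
  map_add' x y := by
    simpa using Rat.cast_add_of_ne_zero (den_ne hp x.2) (den_ne hp y.2)
  map_mul' x y := by
    simpa using Rat.cast_mul_of_ne_zero (den_ne hp x.2) (den_ne hp y.2)

lemma red_eq_zero [Fact p.Prime] {x : Zp p hp} (h : red hp x = 0) :
    (1 / (p : ℚ)) * (x : ℚ) ∈ Zp p hp := by
  have h1 : (((x : ℚ).num : ℤ) : ZMod p) = 0 := by
    have : (((x : ℚ) : ℚ) : ZMod p) = 0 := h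
    rw [Rat.cast_def, div_eq_zero_iff] at this
    exact this.resolve_right (den_ne hp x.2)
  rw [ZMod.intCast_zmod_eq_zero_iff_dvd] at h1
  obtain ⟨c, hc⟩ := h1
  have hp0 : (p : ℚ) ≠ 0 := by exact_mod_cast hp.ne_zero
  have e : (1 / (p : ℚ)) * (x : ℚ) = c * ((x : ℚ).den : ℚ)⁻¹ := by
    conv_lhs => rw [← Rat.num_div_den (x : ℚ), hc]
    push_cast
    field_simp
  rw [e]
  exact mul_mem (intCast_mem _ _) (inv_mem_Zp hp x.2)

/-- Lift of an integral power series to `ℤ_(p)[[q]]`. -/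
def lft (s : IS p hp) : PowerSeries (Zp p hp) :=
  PowerSeries.mk fun n => ⟨PowerSeries.coeff n (s : PowerSeries ℚ), s.2 n⟩

lemma lft_map (s : IS p hp) : PowerSeries.map (Zp p hp).subtype (lft hp s) = s := by
  ext n; simp [lft]

lemma map_inj : Function.Injective (PowerSeries.map (Zp p hp).subtype) :=
  PowerSeries.map_injective _ Subtype.val_injective

/-- Reduction mod `p` of integral power series. -/
def redS [Fact p.Prime] : IS p hp →+* PowerSeries (ZMod p) :=
  (PowerSeries.map (red hp)).comp
    { toFun := lft hp
      map_one' := map_inj hp (by rw [lft_map]; simp)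
      map_zero' := map_inj hp (by rw [lft_map]; simp)
      map_add' := fun a b => map_inj hp (by rw [lft_map, map_add, lft_map, lft_map]; rfl)
      map_mul' := fun a b => map_inj hp (by rw [lft_map, map_mul, lft_map, lft_map]; rfl) }

lemma coeff_redS [Fact p.Prime] (s : IS p hp) (n : ℕ) :
    PowerSeries.coeff n (redS hp s) = ((PowerSeries.coeff n (s : PowerSeries ℚ) : ℚ) : ZMod p) := by
  simp [redS, lft, red]

lemma redS_Dv [Fact p.Prime] (s : IS p hp) (h : Dv hp 1 (s : PowerSeries ℚ)) : redS hp s = 0 := by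
  obtain ⟨u, hu, h⟩ := h
  have : s = (p : IS p hp) * ⟨u, hu⟩ := Subtype.ext (by simpa using h)
  rw [this, map_mul, map_natCast]
  have : (p : PowerSeries (ZMod p)) = 0 := by
    rw [← map_natCast (PowerSeries.C (R := ZMod p)) p, CharP.cast_eq_zero, map_zero]
  rw [this, zero_mul]

/-- Key: a transcendence statement over a field. -/
lemma transc {K : Type*} [Field K] (t : PowerSeries K) (h0 : PowerSeries.constantCoeff t = 1)
    (h1 : t ≠ 1) (q : Polynomial K) (hq : Polynomial.aeval t q = 0) : q = 0 := by
  by_contra hne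
  obtain ⟨g, hg, hnd⟩ := Polynomial.exists_eq_pow_rootMultiplicity_mul_and_not_dvd q hne 1
  rw [hg, map_mul, map_pow] at hq
  have hg0 : Polynomial.aeval t g = 0 := by
    rcases mul_eq_zero.mp hq with h | h
    · exfalso
      have h2 := eq_zero_of_pow_eq_zero h
      simp [sub_eq_zero] at h2
      exact h1 h2
    · exact h
  apply hnd
  rw [Polynomial.dvd_iff_isRoot, Polynomial.IsRoot]
  have h3 := congrArg (PowerSeries.constantCoeff (R := K)) hg0
  rw [Polynomial.aeval_def, Polynomial.hom_eval₂, h0, map_zero] at h3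
  have h4 : (PowerSeries.constantCoeff (R := K)).comp (algebraMap K (PowerSeries K)) = RingHom.id K := by
    ext x; simp
  rw [h4] at h3
  simpa using h3

lemma red1728 [Fact p.Prime] (hp5 : 5 ≤ p) : (1728 : ZMod p) ≠ 0 := by
  have hp : p.Prime := Fact.out
  have : ((1728 : ℕ) : ZMod p) ≠ 0 := by
    rw [Ne, ZMod.natCast_eq_zero_iff]
    intro h
    have h2 : p ∣ 2 ^ 6 * 3 ^ 3 := by simpa using h
    rcases hp.dvd_mul.mp h2 with h | h
    · have := Nat.le_of_dvd (by norm_num) (hp.dvd_of_dvd_pow h); omega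
    · have := Nat.le_of_dvd (by norm_num) (hp.dvd_of_dvd_pow h); omega
  exact_mod_cast this

lemma sigmaQ_one (j : ℕ) : sigmaQ j 1 = 1 := by simp [sigmaQ]

/-- A modular form mod `p` of given weight is determined by its expansion. -/
lemma inj_red [Fact p.Prime] (hp5 : 5 ≤ p) {w : ℕ} {f : Poly3} (hI : Isobaric w f) (hN : NoP f)
    (hf : f ∈ ZP p hp) (h : Dv hp 1 (Phi f)) (m : Fin 3 →₀ ℕ) :
    red hp ⟨coeff m f, hf m⟩ = 0 := by
  set e4 : PowerSeries (ZMod p) := redS hp ⟨E4s, E4s_mem hp⟩ with he4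
  set e6 : PowerSeries (ZMod p) := redS hp ⟨E6s, E6s_mem hp⟩ with he6
  have c4 : PowerSeries.constantCoeff e4 = 1 := by
    rw [← PowerSeries.coeff_zero_eq_constantCoeff_apply, he4, coeff_redS]; simp [E4s]
  have c6 : PowerSeries.constantCoeff e6 = 1 := by
    rw [← PowerSeries.coeff_zero_eq_constantCoeff_apply, he6, coeff_redS]; simp [E6s]
  have d4 : PowerSeries.coeff 1 e4 = 240 := by
    rw [he4, coeff_redS]; simp [E4s, sigmaQ_one]
  have d6 : PowerSeries.coeff 1 e6 = -504 := by
    rw [he6, coeff_redS]; simp [E6s, sigmaQ_one]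
  have n4 : e4 ≠ 0 := fun h => by rw [h] at c4; simp at c4
  have n6 : e6 ≠ 0 := fun h => by rw [h] at c6; simp at c6
  have i4 : e4 * e4⁻¹ = 1 := PowerSeries.mul_inv_cancel _ (by rw [c4]; exact one_ne_zero)
  set t := e6 ^ 2 * e4⁻¹ ^ 3 with ht
  have ht0 : PowerSeries.constantCoeff t = 1 := by
    rw [ht, map_mul, map_pow, map_pow, c6, PowerSeries.constantCoeff_inv, c4]; simp
  have ht1 : t ≠ 1 := by
    intro h
    have h2 : e6 ^ 2 = e4 ^ 3 := by
      calc e6 ^ 2 = e6 ^ 2 * (e4 * e4⁻¹) ^ 3 := by rw [i4]; ring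
        _ = t * e4 ^ 3 := by rw [ht]; ring
        _ = e4 ^ 3 := by rw [h, one_mul]
    have h3 := congrArg (PowerSeries.coeff 1) h2
    rw [PowerSeries.coeff_one_pow, PowerSeries.coeff_one_pow, c4, c6, d4, d6] at h3
    apply red1728 (p := p) hp5
    have : (1728 : ZMod p) = 3 * 240 * 1 - 2 * (-504) * 1 := by norm_num
    rw [this, sub_eq_zero]
    simpa using h3.symm
  -- the relation
  have hrel : ∑ m ∈ f.support, PowerSeries.C (red hp ⟨coeff m f, hf m⟩) * (e4 ^ m 1 * e6 ^ m 2) = 0 := by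
    have hs := redS_Dv hp (∑ m ∈ f.support, (⟨algebraMap ℚ _ (coeff m f), algMap_mem hp (hf m)⟩ : IS p hp)
      * ((⟨E4s, E4s_mem hp⟩ : IS p hp) ^ m 1 * (⟨E6s, E6s_mem hp⟩ : IS p hp) ^ m 2)) (by
        convert h using 1
        rw [Phi_eq]
        push_cast
        refine Finset.sum_congr rfl fun m hm => ?_
        rw [hN m hm, pow_zero, one_mul])
    rw [← hs, map_sum]
    refine Finset.sum_congr rfl fun m hm => ?_
    rw [map_mul, map_mul, map_pow, map_pow]
    congr 1
    ext n
    rw [coeff_redS]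
    change _ = ((PowerSeries.coeff n (algebraMap ℚ (PowerSeries ℚ) (coeff m f)) : ℚ) : ZMod p)
    rw [PowerSeries.algebraMap_apply, PowerSeries.coeff_C, PowerSeries.coeff_C]
    split_ifs <;> simp [red]
  set q : Polynomial (ZMod p) :=
    ∑ m ∈ f.support, Polynomial.monomial (m 2 / 2) (red hp ⟨coeff m f, hf m⟩) with hq
  set r := (w / 2) % 2 with hr
  set N := (w / 2 - 3 * r) / 2 with hNN
  have hq0 : q = 0 := by
    apply transc t ht0 ht1
    have : e4 ^ N * e6 ^ r * Polynomial.aeval t q = 0 := by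
      rw [← hrel, hq, map_sum, Finset.mul_sum]
      refine Finset.sum_congr rfl fun m hm => ?_
      have h1 := hI m hm
      have h2 := hN m hm
      have e1 : N = m 1 + 3 * (m 2 / 2) := by omega
      have e2 : m 2 = r + 2 * (m 2 / 2) := by omega
      rw [Polynomial.aeval_monomial]
      have : e4 ^ m 1 * e6 ^ m 2 = e4 ^ N * e6 ^ r * t ^ (m 2 / 2) := by
        rw [e1, ht]
        conv_lhs => rw [e2]
        generalize m 2 / 2 = b
        calc e4 ^ m 1 * e6 ^ (r + 2 * b) = e4 ^ m 1 * e6 ^ (r + 2 * b) * (e4 * e4⁻¹) ^ (3 * b) := by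
              rw [i4]; ring
          _ = _ := by
              rw [mul_pow, mul_pow, ← pow_mul, ← pow_mul]; ring
      rw [this, PowerSeries.algebraMap_apply, Algebra.algebraMap_self_apply]; ring
    rcases mul_eq_zero.mp this with h | h
    · exact absurd h (mul_ne_zero (pow_ne_zero _ n4) (pow_ne_zero _ n6))
    · exact h
  by_cases hm : m ∈ f.support
  · have h5 := congrArg (fun g => Polynomial.coeff g (m 2 / 2)) hq0
    simp only [hq, Polynomial.finsetSum_coeff, Polynomial.coeff_monomial, Polynomial.coeff_zero] at h5
    rw [Finset.sum_eq_single_of_mem m hm] at h5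
    · simpa using h5
    · intro m' hm' hne
      rw [if_neg]
      intro hb
      apply hne
      have h1 := hI m hm
      have h2 := hN m hm
      have h1' := hI m' hm'
      have h2' := hN m' hm'
      ext i
      fin_cases i
      · simp [h2, h2']
      · simp; omega
      · simp; omega
  · rw [notMem_support_iff] at hm
    have : (⟨coeff m f, hf m⟩ : Zp p hp) = 0 := Subtype.ext hm
    rw [this, map_zero]

lemma inj (hp5 : 5 ≤ p) {w : ℕ} {f : Poly3} (hI : Isobaric w f) (hN : NoP f)
    (hf : f ∈ ZP p hp) (h : Dv hp 1 (Phi f)) :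
    ∃ g ∈ ZP p hp, f = C (p : ℚ) * g ∧ Isobaric w g ∧ NoP g := by
  haveI := Fact.mk hp
  have hp0 : (p : ℚ) ≠ 0 := by exact_mod_cast hp.ne_zero
  refine ⟨C (1 / (p : ℚ)) * f, fun m => ?_, ?_, iso_Cmul _ hI, ?_⟩
  · rw [coeff_C_mul]
    exact red_eq_zero hp (inj_red hp hp5 hI hN hf h m)
  · rw [← mul_assoc, ← C_mul, mul_one_div_cancel hp0]; simp
  · intro m hm
    apply hN m
    rw [mem_support_iff, coeff_C_mul] at hm
    rw [mem_support_iff]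
    exact right_ne_zero_of_mul hm

end RamId

namespace RamId

lemma noP_iff {f : Poly3} : NoP f ↔ pderiv 0 f = 0 := by
  rw [noP_of_coeff]
  constructor
  · intro h
    ext m
    rw [coeff_pd, coeff_zero]
    by_cases h0 : coeff (m + Finsupp.single 0 1) f = 0
    · rw [h0, mul_zero]
    · have := h _ h0
      simp at this
  · intro h m hm
    by_contra h0
    obtain ⟨m', h1, h2⟩ := split_m m
    have h3 := congrArg (coeff (m' + Finsupp.single 0 (m 0 - 1))) h
    rw [coeff_pd, coeff_zero, add_assoc, ← Finsupp.single_add, Nat.sub_add_cancel (by omega), ← h2] at h3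
    rcases mul_eq_zero.mp h3 with h4 | h4
    · exact absurd h4 (Nat.cast_add_one_ne_zero _)
    · exact hm h4

lemma noP_add {f g : Poly3} (hf : NoP f) (hg : NoP g) : NoP (f + g) := by
  rw [noP_iff] at *; rw [map_add, hf, hg, add_zero]
lemma noP_sub {f g : Poly3} (hf : NoP f) (hg : NoP g) : NoP (f - g) := by
  rw [noP_iff] at *; rw [map_sub, hf, hg, sub_zero]
lemma noP_mul {f g : Poly3} (hf : NoP f) (hg : NoP g) : NoP (f * g) := by
  rw [noP_iff] at *; rw [Derivation.leibniz, hf, hg]; simp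
lemma noP_C (c : ℚ) : NoP (C c) := by rw [noP_iff]; simp
lemma noP_pow {f : Poly3} (hf : NoP f) (n : ℕ) : NoP (f ^ n) := by
  induction n with
  | zero => simpa using noP_C 1
  | succ n ih => rw [pow_succ]; exact noP_mul ih hf
lemma noP_X1 : NoP (X 1) := by rw [noP_iff]; simp [pderiv_X]
lemma noP_X2 : NoP (X 2) := by rw [noP_iff]; simp [pderiv_X]
lemma noP_sum {ι : Type*} (s : Finset ι) (f : ι → Poly3) (h : ∀ i ∈ s, NoP (f i)) :
    NoP (∑ i ∈ s, f i) := by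
  rw [noP_iff, map_sum]
  exact Finset.sum_eq_zero fun i hi => noP_iff.mp (h i hi)

variable {p : ℕ} (hp : p.Prime)

lemma Dv_th {e : ℕ} {s : PowerSeries ℚ} (h : Dv hp e s) : Dv hp e (th s) := by
  obtain ⟨u, hu, rfl⟩ := h
  apply Dv_of_coeff
  intro n
  refine ⟨n * PowerSeries.coeff n u, mul_mem (natCast_mem _ _) (hu n), ?_⟩
  have : (p : PowerSeries ℚ) ^ e = PowerSeries.C ((p : ℚ) ^ e) := by simp
  rw [coeff_th, this, PowerSeries.coeff_C_mul]; ring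

lemma Dv_p {s : PowerSeries ℚ} (h : s ∈ IS p hp) : Dv hp 1 ((p : PowerSeries ℚ) * s) :=
  ⟨s, h, by rw [pow_one]⟩

/-- The replacement for `E_{p+1}`. -/
def Bp (p : ℕ) (A : Poly3) : Poly3 := C 12 * Dop A - C ((p - 1 : ℕ) : ℚ) * X 0 * A

lemma Bp_iso (hp1 : 1 ≤ p) {A : Poly3} (hA : Isobaric (p - 1) A) : Isobaric (p + 1) (Bp p A) := by
  have e : p + 1 = p - 1 + 2 := by omega
  refine iso_sub ?_ ?_
  · rw [e]; exact iso_Cmul _ (Dop_iso hA)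
  · rw [e, add_comm]; exact iso_mul (iso_Cmul _ iso_X0) hA

lemma Bp_noP {A : Poly3} (hA : Isobaric (p - 1) A) (hN : NoP A) : NoP (Bp p A) := by
  rw [noP_iff, Bp, map_sub]
  have h1 := pd_Dop_iter hA hN 0
  have h0 := noP_iff.mp hN
  simp only [Function.iterate_zero, id, zero_add, Function.iterate_one] at h1
  rw [Derivation.leibniz, h1, Derivation.leibniz, Derivation.leibniz, h0]
  simp only [smul_eq_mul, mul_zero, zero_add, pderiv_C, add_zero, pderiv_X_self, mul_one]
  rw [← mul_assoc, ← C_mul]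
  have : (12 : ℚ) * (((0 : ℕ) + 1) * ((p - 1 : ℕ) + (0 : ℕ)) / 12) = ((p - 1 : ℕ) : ℚ) := by
    push_cast; ring
  rw [this]; ring

lemma Bp_mem (hp5 : 5 ≤ p) {A : Poly3} (hA : A ∈ ZP p hp) : Bp p A ∈ ZP p hp := by
  refine sub_mem (mul_mem (C_mem_ZP hp ?_) (Dop_mem_ZP hp hp5 hA))
    (mul_mem (mul_mem (C_mem_ZP hp (natCast_mem _ _)) (X_mem_ZP hp 0)) hA)
  exact natCast_mem (Zp p hp) 12

lemma Bp_congr (hp5 : 5 ≤ p) {A : Poly3} (hA : Phi A = EAs p) : Dv hp 1 (Phi (Bp p A) - E2s) := by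
  have h := EAs_congr hp hp5
  have h1 : th (EAs p) = th (EAs p - 1) := by
    rw [map_sub, Derivation.map_one_eq_zero, sub_zero]
  have e : Phi (Bp p A) - E2s = th (EAs p - 1) * ((12 : ℕ) : PowerSeries ℚ)
      - (EAs p - 1) * (((p - 1 : ℕ) : PowerSeries ℚ) * E2s) - (p : PowerSeries ℚ) * E2s := by
    rw [Bp, map_sub, map_mul, map_mul, map_mul, Phi_Dop, hA, Phi_X0, Phi_C, Phi_C, h1, map_natCast,
      Nat.cast_sub (by omega : 1 ≤ p), map_ofNat]
    push_cast
    ring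
  rw [e]
  exact (((Dv_th hp h).mul hp (natCast_mem _ _)).sub hp
    (h.mul hp (mul_mem (natCast_mem _ _) (E2s_mem hp)))).sub hp (Dv_p hp (E2s_mem hp))

lemma C_p (p : ℕ) : (C (p : ℚ) : Poly3) = (p : Poly3) := map_natCast C p

/-- Homogenization of `S` by powers of `A` and `B`. -/
def hom (A B S : Poly3) (N : ℕ) : Poly3 :=
  ∑ m ∈ S.support, C (coeff m S) * (A ^ (N - m 0) * B ^ m 0 * X 1 ^ m 1 * X 2 ^ m 2)

lemma hom_mem {A B S : Poly3} (hA : A ∈ ZP p hp) (hB : B ∈ ZP p hp) (hS : S ∈ ZP p hp) (N : ℕ) :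
    hom A B S N ∈ ZP p hp :=
  sum_mem fun m _ => mul_mem (C_mem_ZP hp (hS m)) (mul_mem (mul_mem (mul_mem (pow_mem hA _)
    (pow_mem hB _)) (pow_mem (X_mem_ZP hp 1) _)) (pow_mem (X_mem_ZP hp 2) _))

lemma hom_noP {A B S : Poly3} (hA : NoP A) (hB : NoP B) (N : ℕ) : NoP (hom A B S N) :=
  noP_sum _ _ fun m _ => noP_mul (noP_C _) (noP_mul (noP_mul (noP_mul (noP_pow hA _)
    (noP_pow hB _)) (noP_pow noP_X1 _)) (noP_pow noP_X2 _))

lemma hom_iso (hp1 : 1 ≤ p) {A B S : Poly3} {w N : ℕ} (hA : Isobaric (p - 1) A)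
    (hB : Isobaric (p + 1) B) (hS : Isobaric w S) (hN : ∀ m, coeff m S ≠ 0 → m 0 ≤ N) :
    Isobaric (w + N * (p - 1)) (hom A B S N) := by
  refine iso_sum _ _ fun m hm => iso_Cmul _ ?_
  have h1 := hS m hm
  have h2 := hN m (mem_support_iff.mp hm)
  have h := iso_mul (iso_mul (iso_mul (iso_pow hA (N - m 0)) (iso_pow hB (m 0))) (iso_pow iso_X1 (m 1)))
    (iso_pow iso_X2 (m 2))
  convert h using 1
  obtain ⟨j, rfl⟩ := Nat.exists_eq_add_of_le h2
  obtain ⟨r, rfl⟩ := Nat.exists_eq_add_of_le hp1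
  rw [← h1]
  simp only [Nat.add_sub_cancel_left]
  ring

lemma hom_succ {A B S : Poly3} {N M : ℕ} (hN : ∀ m, coeff m S ≠ 0 → m 0 ≤ N) :
    hom A B S (N + M) = A ^ M * hom A B S N := by
  rw [hom, hom, Finset.mul_sum]
  refine Finset.sum_congr rfl fun m hm => ?_
  have h2 := hN m (mem_support_iff.mp hm)
  rw [show N + M - m 0 = M + (N - m 0) by omega, pow_add]; ring

lemma hom_congr {A B S : Poly3} (hA : A ∈ ZP p hp) (hB : B ∈ ZP p hp) (hS : S ∈ ZP p hp) (N : ℕ)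
    (h1 : Dv hp 1 (Phi A - 1)) (h2 : Dv hp 1 (Phi B - E2s)) :
    Dv hp 1 (Phi (hom A B S N) - Phi S) := by
  rw [Phi_eq S, hom, map_sum, ← Finset.sum_sub_distrib]
  refine Dv.sum hp _ _ fun m _ => ?_
  rw [map_mul, Phi_C, ← _root_.mul_sub, mul_comm]
  refine Dv.mul hp ?_ (algMap_mem hp (hS m))
  have i4 := pow_mem (E4s_mem hp) (m 1)
  have i6 := pow_mem (E6s_mem hp) (m 2)
  have a1 := h1.pow_sub hp (Phi_mem hp hA) (one_mem _) (N - m 0)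
  have a2 := h2.pow_sub hp (Phi_mem hp hB) (E2s_mem hp) (m 0)
  have a3 := a1.mul_sub hp a2 (pow_mem (Phi_mem hp hB) _) (pow_mem (one_mem _) _)
  have a4 := a3.mul hp (mul_mem i4 i6)
  convert a4 using 1
  simp only [map_mul, map_pow, Phi_X1, Phi_X2, one_pow]
  ring

/-- The case `n = 0`. -/
lemma main0 (hp5 : 5 ≤ p) {A : Poly3} (hAiso : Isobaric (p - 1) A) (hAnoP : NoP A)
    (hAint : A ∈ ZP p hp) (hAPhi : Phi A = EAs p) {k : ℕ} {F : Poly3} (hF : Isobaric (k + 1) F)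
    (hP : NoP F) (hI : F ∈ ZP p hp) :
    ∃ G0 ∈ ZP p hp, ∃ G1 ∈ ZP p hp, ∃ G2 ∈ ZP p hp,
      Dop^[p ^ 2] F = (p : Poly3) ^ 2 * G0 + (p : Poly3) * A ^ p * G1 + A ^ (p * 2) * G2 := by
  have hp0 := hp.ne_zero
  obtain ⟨S, hS, eS, iS, bS⟩ := decomp hp hp5 hF hP hI p hp0
  obtain ⟨T, hT, eT, iT, -⟩ := decomp hp hp5 hF hP hI (p ^ 2) (pow_ne_zero 2 hp0)
  set K := pf (Dop^[p] F) with hK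
  set G := pf (Dop^[p ^ 2] F) with hG
  have mK : K ∈ ZP p hp := pf_mem hp (Dop_iter_mem_ZP hp hp5 hI p)
  have mG : G ∈ ZP p hp := pf_mem hp (Dop_iter_mem_ZP hp hp5 hI (p ^ 2))
  have iK : Isobaric (k + 1 + 2 * p) K := pf_iso (Dop_iter_iso hF p)
  have iG : Isobaric (k + 1 + 2 * p ^ 2) G := pf_iso (Dop_iter_iso hF (p ^ 2))
  have nK : NoP K := pf_noP _
  have nG : NoP G := pf_noP _
  have hA1 : Dv hp 1 (Phi A - 1) := by rw [hAPhi]; exact EAs_congr hp hp5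
  have hwt : ∀ a : ℕ, a + 2 * p + 2 * p * (p - 1) = a + 2 * p ^ 2 := by
    intro a
    obtain ⟨r, rfl⟩ := Nat.exists_eq_add_of_le hp.one_le
    simp only [Nat.add_sub_cancel_left]; ring
  -- first congruence
  have c1 : Dv hp 2 (Phi (G - A ^ (2 * p) * K) - (p : PowerSeries ℚ) * Phi S) := by
    have t1 := theta_congr hp hI
    have t2 := (hA1.pow_p hp (Phi_mem hp hAint) 2).mul hp (Phi_mem hp mK)
    have t3 : Dv hp 2 ((p : PowerSeries ℚ) ^ 2 * Phi T) := ⟨Phi T, Phi_mem hp hT, rfl⟩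
    have := (t1.sub hp t2).sub hp t3
    convert this using 1
    rw [eS, eT]
    simp only [map_add, map_sub, map_mul, map_pow, Phi_C]
    push_cast
    try simp only [map_pow, map_natCast]
    ring
  have mD : G - A ^ (2 * p) * K ∈ ZP p hp := sub_mem mG (mul_mem (pow_mem hAint _) mK)
  have iD : Isobaric (k + 1 + 2 * p ^ 2) (G - A ^ (2 * p) * K) := by
    refine iso_sub iG ?_
    have := iso_mul (iso_pow hAiso (2 * p)) iK
    rwa [add_comm, hwt] at this
  have nD : NoP (G - A ^ (2 * p) * K) := noP_sub nG (noP_mul (noP_pow hAnoP _) nK)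
  have dD : Dv hp 1 (Phi (G - A ^ (2 * p) * K)) := by
    have := (c1.mono hp (by norm_num : 1 ≤ 2)).add hp (Dv_p hp (Phi_mem hp hS))
    simpa using this
  obtain ⟨H, mH, eH, iH, nH⟩ := inj hp hp5 iD nD mD dD
  have c2 : Dv hp 1 (Phi H - Phi S) := by
    apply Dv.cancel
    convert c1 using 1
    rw [eH, map_mul, Phi_C, map_natCast]; ring
  set B := Bp p A with hB
  have mB : B ∈ ZP p hp := Bp_mem hp hp5 hAint
  have iB : Isobaric (p + 1) B := Bp_iso hp.one_le hAiso
  have nB : NoP B := Bp_noP hAiso hAnoP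
  have cB : Dv hp 1 (Phi B - E2s) := Bp_congr hp hp5 hAPhi
  set St := hom A B S (p + p) with hSt
  have mSt : St ∈ ZP p hp := hom_mem hp hAint mB hS _
  have iSt : Isobaric (k + 1 + 2 * p ^ 2) St := by
    have := hom_iso hp.one_le hAiso iB iS (N := p + p) (fun m hm => (bS m hm).trans (by omega))
    have e2 : k + 1 + 2 * p + (p + p) * (p - 1) = k + 1 + 2 * p ^ 2 := by rw [← hwt]; ring
    rwa [e2] at this
  have nSt : NoP St := hom_noP hAnoP nB _
  have c3 : Dv hp 1 (Phi (H - St)) := by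
    have := c2.sub hp (hom_congr hp hAint mB hS (p + p) hA1 cB)
    convert this using 1
    rw [map_sub]; ring
  obtain ⟨H', mH', eH', -, -⟩ := inj hp hp5 (iso_sub iH iSt) (noP_sub nH nSt) (sub_mem mH mSt) c3
  refine ⟨T + H', add_mem hT mH', hom A B S p, hom_mem hp hAint mB hS _, K, mK, ?_⟩
  have eSt : St = A ^ p * hom A B S p := hom_succ bS
  have e1 : G = A ^ (2 * p) * K + C (p : ℚ) * H := by rw [← eH]; ring
  have e2 : H = St + C (p : ℚ) * H' := by rw [← eH']; ring
  rw [eT, e1, e2, eSt, C_p, show (C ((p ^ 2 : ℕ) : ℚ) : Poly3) = (p : Poly3) ^ 2 by rw [C_p]; push_cast; rfl]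
  ring

/-- Step 0: low weight forms in the `n`-th power of the ideal are divisible by `p ^ n`. -/
lemma low_weight {A : Poly3} (hAiso : Isobaric (p - 1) A) {k n : ℕ} (hk : k < p * (p - 1)) {F : Poly3}
    (hF : Isobaric k F) (h : InIdealPow p A n F) : ∃ F' ∈ ZP p hp, F = C ((p : ℚ) ^ n) * F' := by
  obtain ⟨G, hG, e⟩ := h
  have hp0 : ((p : ℚ) ^ n) ≠ 0 := pow_ne_zero _ (by exact_mod_cast hp.ne_zero)
  refine ⟨C (1 / (p : ℚ) ^ n) * F, ?_, ?_⟩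
  swap
  · rw [← mul_assoc, ← C_mul, mul_one_div_cancel hp0]; simp
  intro m
  rw [coeff_C_mul]
  by_cases hm : coeff m F = 0
  · rw [hm, mul_zero]; exact zero_mem (Zp p hp)
  have hw := iso_of_coeff.mp hF m hm
  have : coeff m F = (p : ℚ) ^ n * coeff m (G 0) := by
    rw [e, coeff_sum, Finset.sum_eq_single_of_mem 0 (by simp)]
    · simp only [Nat.sub_zero, mul_zero, pow_zero, mul_one]
      rw [← C_p, ← C_pow, coeff_C_mul]
    · intro i _ hi
      have hz : ∀ g : Poly3, coeff m (A ^ (p * i) * g) = 0 := by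
        intro g
        rw [coeff_mul]
        refine Finset.sum_eq_zero fun x hx => ?_
        by_contra hne
        have h1 := iso_of_coeff.mp (iso_pow hAiso (p * i)) x.1 (left_ne_zero_of_mul hne)
        have h2 : x.1 + x.2 = m := by simpa using hx
        have h3 : p * (p - 1) ≤ p * i * (p - 1) :=
          Nat.mul_le_mul_right _ (Nat.le_mul_of_pos_right _ (Nat.pos_of_ne_zero hi))
        have a0 := DFunLike.congr_fun h2 0
        have a1 := DFunLike.congr_fun h2 1
        have a2 := DFunLike.congr_fun h2 2
        simp only [Finsupp.add_apply] at a0 a1 a2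
        omega
      rw [← C_p, ← C_pow, mul_assoc, coeff_C_mul, hz, mul_zero]
  rw [this, ← mul_assoc, one_div_mul_cancel hp0, one_mul]
  exact hG 0 m

lemma Dop_iter_C_mul (c : ℚ) (f : Poly3) (M : ℕ) : Dop^[M] (C c * f) = C c * Dop^[M] f := by
  induction M with
  | zero => simp
  | succ M ih => rw [Function.iterate_succ_apply', ih, Dop_C_mul, Function.iterate_succ_apply']

lemma main (p : ℕ) (hp : p.Prime) (hp5 : 5 ≤ p)
    (A : Poly3) (hAiso : Isobaric (p - 1) A) (hAnoP : NoP A)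
    (hAint : polyPInt p A) (hAPhi : Phi A = EAs p)
    (k : ℕ) (hk : 0 < k) (F : Poly3) (hFiso : Isobaric k F) (hFnoP : NoP F)
    (hpk : 2 * k - 2 ≤ p)
    (n : ℕ) (hF : InIdealPow p A n F) :
    InIdealPow p A (n + 2) (Dop^[p ^ 2] F) := by
  have hkp : k < p * (p - 1) := by
    have : p * 4 ≤ p * (p - 1) := Nat.mul_le_mul_left _ (by omega)
    omega
  obtain ⟨F', mF', eF⟩ := low_weight hp hAiso hkp hFiso hF
  have hp0 : ((p : ℚ) ^ n) ≠ 0 := pow_ne_zero _ (by exact_mod_cast hp.ne_zero)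
  have eF' : F' = C (1 / (p : ℚ) ^ n) * F := by
    rw [eF, ← mul_assoc, ← C_mul, one_div_mul_cancel hp0]; simp
  have iF' : Isobaric k F' := by rw [eF']; exact iso_Cmul _ hFiso
  have nF' : NoP F' := by rw [eF']; exact noP_mul (noP_C _) hFnoP
  obtain ⟨j, rfl⟩ : ∃ j, k = j + 1 := ⟨k - 1, by omega⟩
  obtain ⟨G0, m0, G1, m1, G2, m2, e⟩ := main0 hp hp5 hAiso hAnoP hAint hAPhi iF' nF' mF'
  refine ⟨fun i => if i = 0 then G0 else if i = 1 then G1 else if i = 2 then G2 else 0, fun i => ?_, ?_⟩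
  · dsimp only
    split_ifs
    · exact m0
    · exact m1
    · exact m2
    · exact zero_mem (ZP p hp)
  · rw [eF, Dop_iter_C_mul, e]
    rw [← Finset.sum_subset (Finset.range_subset_range.mpr (by omega : 3 ≤ n + 2 + 1))]
    · rw [Finset.sum_range_succ, Finset.sum_range_succ, Finset.sum_range_one]
      rw [C_pow, C_p, show n + 2 - 0 = n + 2 by omega, show n + 2 - 1 = n + 1 by omega,
        show n + 2 - 2 = n by omega]
      simp
      ring
    · intro i _ hi
      have : 3 ≤ i := by simpa using hi
      dsimp only
      rw [if_neg (by omega), if_neg (by omega), if_neg (by omega), mul_zero]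

end RamId

theorem stmt_16 (p : ℕ) (hp : p.Prime) (hp5 : 5 ≤ p)
    (A : Poly3) (hAiso : Isobaric (p - 1) A) (hAnoP : NoP A)
    (hAint : polyPInt p A) (hAPhi : Phi A = EAs p)
    (k : ℕ) (hk : 0 < k) (F : Poly3) (hFiso : Isobaric k F) (hFnoP : NoP F)
    (hFint : polyPInt p F) (hpk : 2 * k - 2 ≤ p)
    (n : ℕ) (hn : n ≤ k - 1) (hF : InIdealPow p A n F) :
    InIdealPow p A (n + 2) (Dop^[p ^ 2] F) := by
  exact RamId.main p hp hp5 A hAiso hAnoP hAint hAPhi k hk F hFiso hFnoP hpk n hF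
end
end

section
/- Let p ≥ 5 be a prime, let k be a positive integer with p ≥ 2k−2, and let F ∈ ℤ_(p)[Q,R] be isobaric of weight k and not involving P. If F lies in (A^p, p)ⁿ for an integer n with 0 ≤ n ≤ k−2, then D^{p²−p}F lies in (A^p, p)^{n+1}; in other words, if v(F) ≤ k−2 then v(D^{p²−p}F) ≥ v(F) + 1. -/
open MvPolynomial Finset

noncomputable section

section Ramanujan
open UpperHalfPlane hiding I
open Complex Derivative ModularForm EisensteinSeries
open scoped Manifold MatrixGroups ModularForm Topology

local notation "qq" => Function.Periodic.qParam (1:ℝ)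

/-- `f` is the sum of its `q`-expansion `a`. -/
def HasQ (f : ℍ → ℂ) (a : PowerSeries ℂ) : Prop :=
  ∀ τ : ℍ, HasSum (fun m : ℕ => PowerSeries.coeff m a • qq τ ^ m) (f τ)

lemma HasQ.add {f g a b} (hf : HasQ f a) (hg : HasQ g b) : HasQ (f + g) (a + b) := by
  intro τ
  simpa [add_mul] using (hf τ).add (hg τ)

lemma HasQ.smul {f a} (c : ℂ) (hf : HasQ f a) : HasQ (c • f) (c • a) := by
  intro τ
  simpa [mul_assoc] using (hf τ).mul_left c

lemma HasQ.mul {f g a b} (hf : HasQ f a) (hg : HasQ g b) : HasQ (f * g) (a * b) := by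
  intro τ
  have h1 := summable_norm_iff.mpr (hf τ).summable
  have h2 := summable_norm_iff.mpr (hg τ).summable
  have h3 := (summable_norm_sum_mul_antidiagonal_of_summable_norm h1 h2).of_norm
  have h4 := tsum_mul_tsum_eq_tsum_sum_antidiagonal_of_summable_norm h1 h2
  rw [(hf τ).tsum_eq, (hg τ).tsum_eq] at h4
  rw [Pi.mul_apply, h4]
  convert! h3.hasSum using 2 with m
  rw [PowerSeries.coeff_mul, smul_eq_mul, Finset.sum_mul]
  refine Finset.sum_congr rfl fun ij hij => ?_
  rw [← Finset.HasAntidiagonal.mem_antidiagonal.mp hij, pow_add]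
  simp only [smul_eq_mul]; ring

/-- `q d/dq` on power series. -/
def thetaD (R : Type*) [CommRing R] : Derivation R (PowerSeries R) (PowerSeries R) :=
  (PowerSeries.X : PowerSeries R) • PowerSeries.derivative R

lemma coeff_thetaD {R : Type*} [CommRing R] (a : PowerSeries R) (n : ℕ) :
    PowerSeries.coeff n (thetaD R a) = n * PowerSeries.coeff n a := by
  cases n with
  | zero => simp [thetaD]
  | succ n => 
    simp [thetaD, PowerSeries.coeff_succ_X_mul, PowerSeries.coeff_derivative]; ring

lemma HasQ.deriv {f a} (hf : HasQ f a) : HasQ (D f) (thetaD ℂ a) := by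
  intro τ
  have hpos : 0 < τ.im / 2 := by have := τ.im_pos; positivity
  set τ' : ℍ := ⟨(τ.im / 2 : ℝ) * I, by simpa using τ.im_pos⟩ with hτ'
  have hsum := summable_norm_iff.mpr (hf τ').summable
  set U : Set ℂ := {w | τ.im / 2 < w.im} with hU
  have hUo : IsOpen U := isOpen_lt continuous_const Complex.continuous_im
  have hτU : (τ : ℂ) ∈ U := by
    have := τ.im_pos
    simp only [hU, Set.mem_ofPred_eq, UpperHalfPlane.coe_im]; linarith
  have hqd : ∀ (m : ℕ) (w : ℂ), HasDerivAt (fun w : ℂ => PowerSeries.coeff m a * qq w ^ m)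
      (PowerSeries.coeff m a * (m * (2 * Real.pi * I) * qq w ^ m)) w := by
    intro m w
    have h0 : HasDerivAt (fun w : ℂ => qq w) ((2 * Real.pi * I) * qq w) w := by
      have : HasDerivAt (fun w : ℂ => 2 * Real.pi * I * w / (1:ℝ)) (2 * Real.pi * I) w := by
        simpa using (hasDerivAt_id w).const_mul (2 * Real.pi * I : ℂ)
      have := this.cexp
      convert! this using 1
      simp [Function.Periodic.qParam]; ring
    have h1 := (h0.pow m).const_mul (PowerSeries.coeff m a)
    convert! h1 using 1
    cases m with
    | zero => simp
    | succ m => push_cast; rw [pow_succ]; ring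
  have key := hasSum_deriv_of_summable_norm (F := fun (m : ℕ) (w : ℂ) => PowerSeries.coeff m a * qq w ^ m)
    hsum (fun m => fun w _ => (hqd m w).differentiableAt.differentiableWithinAt) hUo
    (fun m w hw => by
      simp only [smul_eq_mul, norm_mul, norm_pow]
      gcongr
      rw [Function.Periodic.norm_qParam, Function.Periodic.norm_qParam]
      apply Real.exp_le_exp.mpr
      have hw' : τ.im / 2 < w.im := hw
      have : (τ' : ℂ).im = τ.im / 2 := by simp [hτ']
      rw [this]
      have := Real.pi_pos
      simp only [div_one]
      nlinarith) hτU
  have heq : (fun w => ∑' m, PowerSeries.coeff m a * qq w ^ m) =ᶠ[𝓝 (τ : ℂ)] f ∘ ofComplex := by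
    filter_upwards [hUo.mem_nhds hτU] with w hw
    have hw' : 0 < w.im := hpos.trans hw
    have := (hf ⟨w, hw'⟩).tsum_eq
    simp only [smul_eq_mul] at this
    rw [Function.comp_apply, ofComplex_apply_of_im_pos hw']
    exact this
  rw [heq.deriv_eq] at key
  have key2 := key.mul_left (2 * Real.pi * I)⁻¹
  have hne : (2 * Real.pi * I : ℂ) ≠ 0 := by simp [Real.pi_ne_zero]
  convert! key2 using 2 with m
  rw [(hqd m τ).deriv, coeff_thetaD, smul_eq_mul]
  field_simp

lemma hasQ_zero_of_small {k : ℤ} (hk : k.toNat / 12 = 0) {f : ℍ → ℂ} {a : PowerSeries ℂ}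
    (hf : HasQ f a) (hd : MDiff f) (hs : ∀ γ : SL(2, ℤ), f ∣[k] γ = f)
    (h0 : PowerSeries.coeff 0 a = 0) : a = 0 := by
  have hb : IsBoundedAtImInfty f := isBoundedAtImInfty_of_hasSum_qExpansion one_pos hf
  let F : ModularForm 𝒮ℒ k :=
    { toFun := f
      slash_action_eq' := by
        rintro _ ⟨γ, rfl⟩
        exact hs γ
      holo' := hd
      bdd_at_cusps' := by
        intro c hc
        rw [Subgroup.IsArithmetic.isCusp_iff_isCusp_SL2Z] at hc
        rw [OnePoint.isBoundedAt_iff_forall_SL2Z hc]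
        intro γ _
        rw [hs γ]
        exact hb }
  have hu : ∀ m, PowerSeries.coeff m a = (qExpansion 1 F).coeff m :=
    fun m => ModularFormClass.qExpansion_coeff_unique (f := F) one_pos one_mem_strictPeriods_SL hf m
  have hE : a = qExpansion 1 F := by ext m; exact hu m
  have hF : F = 0 := by
    apply sturm_bound_levelOne
    rw [hk, ← hE]
    simp only [Nat.cast_zero]
    rw [pos_iff_ne_zero]
    exact PowerSeries.order_ne_zero_iff_constCoeff_eq_zero.mpr (by simpa using h0)
  rw [hE, hF]
  simpa using qExpansion_zero (1:ℝ)

lemma HasQ.congr {f g a} (hf : HasQ f a) (h : ∀ τ, g τ = f τ) : HasQ g a := by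
  intro τ; rw [h τ]; exact hf τ


lemma E2_serre_slash (γ : SL(2, ℤ)) :
    (serreDerivative 1 E2) ∣[(4:ℤ)] γ = serreDerivative 1 E2 := by
  have h1 := serreDerivative_slash_equivariant (k := 2) E2_mdifferentiable (γ := γ)
  have hE := E2_slash_action γ
  have hsq := mul_slash_SL2 2 2 γ E2 E2
  have hone : MDiff (fun _ : ℍ => (1:ℂ)) := mdifferentiable_const
  have h2 := normalizedDerivOfComplex_SL_slash (k := 1) hone (γ := γ)
  have h3 : (fun _ : ℍ => (1:ℂ)) ∣[(1:ℤ)] γ = fun z : ℍ => (denom γ z)⁻¹ := by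
    ext z
    simp [SL_slash_apply]
  have hz : D ((fun _ : ℍ => (1:ℂ))) = 0 := normalizedDerivOfComplex_const 1
  rw [hz, SlashAction.zero_slash, h3] at h2
  have hmd : MDiff (fun z : ℍ => (denom γ z)⁻¹) := by
    rw [← h3]; exact hone.slash 1 _
  set κ : ℂ := (1 / (2 * riemannZeta 2)) * (2 * Real.pi * I * γ 1 0) with hκ
  have hg : (1 / (2 * riemannZeta 2)) • D2 γ = κ • (fun z : ℍ => (denom γ z)⁻¹) := by
    ext z
    simp [D2, hκ]; ring
  have hser : serreDerivative 1 E2 = serreDerivative 2 E2 + (1/12 : ℂ) • (E2 * E2) := by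
    ext z; simp [serreDerivative]; ring
  rw [hg] at hE
  have hDg := normalizedDerivOfComplex_smul κ _ hmd
  have hDs := normalizedDerivOfComplex_sub E2 _ E2_mdifferentiable (hmd.const_smul κ)
  rw [hser, SlashAction.add_slash, SL_smul_slash]
  have h1' : serreDerivative 2 E2 ∣[(4:ℤ)] γ = serreDerivative 2 (E2 ∣[(2:ℤ)] γ) := by
    simpa using h1
  have hsq' : (E2 * E2) ∣[(4:ℤ)] γ = E2 ∣[(2:ℤ)] γ * E2 ∣[(2:ℤ)] γ := by simpa using hsq
  rw [h1', hsq', hE]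
  ext z
  have hd : denom γ z ≠ 0 := denom_ne_zero _ _
  have e1 := congrFun hDs z
  have e2 := congrFun hDg z
  have e3 := congrFun h2 z
  simp only [Pi.sub_apply, Pi.smul_apply, smul_eq_mul, Pi.zero_apply] at e1 e2 e3
  simp only [Pi.add_apply, Pi.smul_apply, Pi.mul_apply, serreDerivative, smul_eq_mul, Pi.sub_apply]
  rw [e1, e2, e3]
  have hpi : (Real.pi : ℂ) ≠ 0 := by exact_mod_cast Real.pi_ne_zero
  have hκ' : κ = 6 * I * γ 1 0 / Real.pi := by
    rw [hκ, riemannZeta_two]; field_simp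
  have hI : I⁻¹ = - I := Complex.inv_I
  have : κ * (0 - ((1:ℤ):ℂ) * (2 * Real.pi * I)⁻¹ * (γ 1 0 / denom γ z) * (denom γ z)⁻¹)
     = (1/12) * (κ * (denom γ z)⁻¹) * (κ * (denom γ z)⁻¹) := by
    rw [hκ', mul_inv, mul_inv, hI]
    field_simp
    push_cast
    ring_nf
    try simp [Complex.I_sq]
  rw [this]
  ring

lemma hasQ_modform {k : ℤ} (f : ModularForm 𝒮ℒ k) : HasQ f (qExpansion 1 f) := by
  intro τ
  exact ModularForm.hasSum_qExpansion f one_pos one_mem_strictPeriods_SL τ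

/-- Integral Eisenstein-type series. -/
def eis (c : ℤ) (j : ℕ) : PowerSeries ℤ :=
  PowerSeries.mk fun m => if m = 0 then 1 else c * ((ArithmeticFunction.sigma j) m : ℤ)

/-- Base change of `eis`. -/
def eisR (R : Type*) [CommRing R] (c : ℤ) (j : ℕ) : PowerSeries R :=
  PowerSeries.map (Int.castRingHom R) (eis c j)

lemma hasQ_E2 : HasQ E2 (eisR ℂ (-24) 1) := by
  intro τ
  have := hasSum_qExpansion_E2 τ
  convert! this using 2 with m
  rcases eq_or_ne m 0 with rfl | h <;>
  simp [Function.Periodic.qParam, eisR, eis, *]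

lemma bern4 : bernoulli 4 = -1/30 := by
  rw [bernoulli_eq_bernoulli'_of_ne_one (by norm_num)]; exact bernoulli'_four

lemma bern6 : bernoulli 6 = 1/42 := by
  rw [bernoulli_eq_bernoulli'_of_ne_one (by norm_num), bernoulli'_def]
  have h5 : bernoulli' 5 = 0 := bernoulli'_eq_zero_of_odd (by decide) (by norm_num)
  simp [Finset.sum_range_succ, bernoulli'_four, h5]
  norm_num [Nat.choose]

lemma hasQ_E4 : HasQ E₄ (eisR ℂ 240 3) := by
  convert! hasQ_modform E₄ using 1
  ext m
  have := E_qExpansion_coeff (k := 4) (by norm_num) (by decide) m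
  erw [this]
  rcases eq_or_ne m 0 with rfl | h
  · simp [eisR, eis]
  · simp [eisR, eis, bern4, h]; norm_num

lemma hasQ_E6 : HasQ E₆ (eisR ℂ (-504) 5) := by
  convert! hasQ_modform E₆ using 1
  ext m
  have := E_qExpansion_coeff (k := 6) (by norm_num) (by decide) m
  erw [this]
  rcases eq_or_ne m 0 with rfl | h
  · simp [eisR, eis]
  · simp [eisR, eis, bern6, h]; norm_num

lemma HasQ.serre {f a} (k : ℂ) (hf : HasQ f a) :
    HasQ (serreDerivative k f) (thetaD ℂ a + (-(k/12)) • (eisR ℂ (-24) 1 * a)) := by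
  refine (hf.deriv.add ((hasQ_E2.mul hf).smul (-(k/12)))).congr fun τ => ?_
  simp [serreDerivative]; ring

lemma constCoeff_thetaD {R : Type*} [CommRing R] (a : PowerSeries R) :
    PowerSeries.constantCoeff (thetaD R a) = 0 := by
  simp [thetaD]

lemma constCoeff_eisR {R : Type*} [CommRing R] (c : ℤ) (j : ℕ) :
    PowerSeries.constantCoeff (eisR R c j) = 1 := by
  rw [← PowerSeries.coeff_zero_eq_constantCoeff_apply]
  simp [eisR, eis]

lemma slash_SL {k : ℤ} (f : ModularForm 𝒮ℒ k) (γ : SL(2, ℤ)) : (f : ℍ → ℂ) ∣[k] γ = f :=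
  SlashInvariantForm.slash_action_eqn f _ ⟨γ, rfl⟩

lemma smulC (c : ℂ) (a : PowerSeries ℂ) : c • a = PowerSeries.C c * a :=
  PowerSeries.smul_eq_C_mul a c

lemma ram2C : 12 * thetaD ℂ (eisR ℂ (-24) 1) = eisR ℂ (-24) 1 ^ 2 - eisR ℂ 240 3 := by
  have h := hasQ_zero_of_small (k := 4) (by decide)
    ((hasQ_E2.serre 1).add (hasQ_E4.smul (1/12)))
    ((serreDerivative_mdifferentiable 1 E2_mdifferentiable).add (E₄.holo'.const_smul _))
    (fun γ => by
      rw [SlashAction.add_slash, SL_smul_slash, E2_serre_slash, slash_SL])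
    (by simp [constCoeff_thetaD, constCoeff_eisR])
  have h12 : (PowerSeries.C (12:ℂ) : PowerSeries ℂ) = 12 := map_ofNat PowerSeries.C 12
  have h2 : PowerSeries.C (12:ℂ) * PowerSeries.C (1/12 : ℂ) = 1 := by
    rw [← map_mul]; simp
  rw [smulC, smulC, map_neg] at h
  rw [h12] at h2
  linear_combination 12 * h - (eisR ℂ 240 3 - eisR ℂ (-24) 1 ^ 2) * h2

lemma ram4C : 3 * thetaD ℂ (eisR ℂ 240 3)
    = eisR ℂ (-24) 1 * eisR ℂ 240 3 - eisR ℂ (-504) 5 := by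
  have h := hasQ_zero_of_small (k := 6) (by decide)
    ((hasQ_E4.serre 4).add (hasQ_E6.smul (1/3)))
    ((serreDerivative_mdifferentiable 4 E₄.holo').add (E₆.holo'.const_smul _))
    (fun γ => by
      have := serreDerivative_slash_invariant (k := 4) E₄.holo' (slash_SL E₄ γ)
      have h' : serreDerivative 4 E₄ ∣[(6:ℤ)] γ = serreDerivative 4 E₄ := by simpa using this
      rw [SlashAction.add_slash, SL_smul_slash, h', slash_SL])
    (by simp [constCoeff_thetaD, constCoeff_eisR]; norm_num)
  have h12 : (PowerSeries.C (3:ℂ) : PowerSeries ℂ) = 3 := map_ofNat PowerSeries.C 3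
  have h2 : PowerSeries.C (3:ℂ) * PowerSeries.C (1/3 : ℂ) = 1 := by
    rw [← map_mul]; simp
  rw [smulC, smulC, map_neg, show (4/12:ℂ) = 1/3 by norm_num] at h
  rw [h12] at h2
  linear_combination 3 * h - (eisR ℂ (-504) 5 - eisR ℂ (-24) 1 * eisR ℂ 240 3) * h2

lemma ram6C : 2 * thetaD ℂ (eisR ℂ (-504) 5)
    = eisR ℂ (-24) 1 * eisR ℂ (-504) 5 - eisR ℂ 240 3 ^ 2 := by
  have h := hasQ_zero_of_small (k := 8) (by decide)
    ((hasQ_E6.serre 6).add ((hasQ_E4.mul hasQ_E4).smul (1/2)))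
    ((serreDerivative_mdifferentiable 6 E₆.holo').add ((E₄.holo'.mul E₄.holo').const_smul _))
    (fun γ => by
      have := serreDerivative_slash_invariant (k := 6) E₆.holo' (slash_SL E₆ γ)
      have h' : serreDerivative 6 E₆ ∣[(8:ℤ)] γ = serreDerivative 6 E₆ := by simpa using this
      have h4 := mul_slash_SL2 4 4 γ E₄ E₄
      rw [slash_SL] at h4
      have h4' : ((E₄ : ℍ → ℂ) * E₄) ∣[(8:ℤ)] γ = (E₄ : ℍ → ℂ) * E₄ := by simpa using h4
      rw [SlashAction.add_slash, SL_smul_slash, h', h4'])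
    (by simp [constCoeff_thetaD, constCoeff_eisR]; norm_num)
  have h12 : (PowerSeries.C (2:ℂ) : PowerSeries ℂ) = 2 := map_ofNat PowerSeries.C 2
  have h2 : PowerSeries.C (2:ℂ) * PowerSeries.C (1/2 : ℂ) = 1 := by
    rw [← map_mul]; simp
  rw [smulC, smulC, map_neg, show (6/12:ℂ) = 1/2 by norm_num] at h
  rw [h12] at h2
  linear_combination 2 * h - (eisR ℂ 240 3 ^ 2 - eisR ℂ (-24) 1 * eisR ℂ (-504) 5) * h2

lemma thetaD_map {R S : Type*} [CommRing R] [CommRing S] (φ : R →+* S) (a : PowerSeries R) :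
    thetaD S (PowerSeries.map φ a) = PowerSeries.map φ (thetaD R a) := by
  ext n
  simp [coeff_thetaD]

lemma mapC_inj : Function.Injective (PowerSeries.map (Int.castRingHom ℂ)) :=
  PowerSeries.map_injective _ Int.cast_injective

lemma ram2 (R : Type*) [CommRing R] :
    12 * thetaD R (eisR R (-24) 1) = eisR R (-24) 1 ^ 2 - eisR R 240 3 := by
  have h : 12 * thetaD ℤ (eis (-24) 1) = eis (-24) 1 ^ 2 - eis 240 3 := by
    apply mapC_inj
    simpa [← thetaD_map, eisR, map_ofNat (PowerSeries.map (Int.castRingHom ℂ)) 12] using ram2C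
  simpa [← thetaD_map, eisR, map_ofNat (PowerSeries.map (Int.castRingHom R)) 12] using congrArg (PowerSeries.map (Int.castRingHom R)) h

lemma ram4 (R : Type*) [CommRing R] : 3 * thetaD R (eisR R 240 3)
    = eisR R (-24) 1 * eisR R 240 3 - eisR R (-504) 5 := by
  have h : 3 * thetaD ℤ (eis 240 3) = eis (-24) 1 * eis 240 3 - eis (-504) 5 := by
    apply mapC_inj
    simpa [← thetaD_map, eisR, map_ofNat (PowerSeries.map (Int.castRingHom ℂ)) 3] using ram4C
  simpa [← thetaD_map, eisR, map_ofNat (PowerSeries.map (Int.castRingHom R)) 3] using congrArg (PowerSeries.map (Int.castRingHom R)) h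

lemma ram6 (R : Type*) [CommRing R] : 2 * thetaD R (eisR R (-504) 5)
    = eisR R (-24) 1 * eisR R (-504) 5 - eisR R 240 3 ^ 2 := by
  have h : 2 * thetaD ℤ (eis (-504) 5) = eis (-24) 1 * eis (-504) 5 - eis 240 3 ^ 2 := by
    apply mapC_inj
    simpa [← thetaD_map, eisR, map_ofNat (PowerSeries.map (Int.castRingHom ℂ)) 2] using ram6C
  simpa [← thetaD_map, eisR, map_ofNat (PowerSeries.map (Int.castRingHom R)) 2] using congrArg (PowerSeries.map (Int.castRingHom R)) h

end Ramanujan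

section CharP

variable {R M : Type*} [CommRing R] [CommRing M] [Algebra R M]

lemma iter_leibniz (D : Derivation R M M) (n : ℕ) (f g : M) :
    D^[n] (f * g) = ∑ ij ∈ Finset.HasAntidiagonal.antidiagonal n,
      (n.choose ij.1 : M) * (D^[ij.1] f * D^[ij.2] g) := by
  induction n with
  | zero => simp
  | succ n ih =>
    rw [Function.iterate_succ_apply', ih,
      Finset.sum_antidiagonal_choose_succ_mul (fun i j => D^[i] f * D^[j] g), map_sum,
      ← Finset.sum_add_distrib]
    refine Finset.sum_congr rfl fun ij hij => ?_
    rw [Nat.choose_symm_of_eq_add (Finset.HasAntidiagonal.mem_antidiagonal.mp hij).symm]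
    simp only [Derivation.leibniz, Derivation.map_natCast, smul_eq_mul,
      Function.iterate_succ_apply']
    ring

lemma iter_leibniz_p (p : ℕ) (hp : p.Prime) [CharP M p] (D : Derivation R M M) (f g : M) :
    D^[p] (f * g) = f * D^[p] g + g * D^[p] f := by
  rw [iter_leibniz, Finset.Nat.sum_antidiagonal_eq_sum_range_succ_mk, Finset.sum_range_succ,
    ← Nat.sub_add_cancel hp.one_le, Finset.sum_range_succ', Nat.sub_add_cancel hp.one_le]
  rw [Finset.sum_eq_zero]
  · simp; ring
  · intro i hi
    have hi' := Finset.mem_range.mp hi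
    have : ((p.choose (i+1) : ℕ) : M) = 0 := by
      rw [CharP.cast_eq_zero_iff M p]
      exact hp.dvd_choose_self (by omega) (by omega)
    simp [this]

/-- The `p`-th iterate of a derivation in characteristic `p`. -/
def iterP (p : ℕ) (hp : p.Prime) [CharP M p] (D : Derivation R M M) : Derivation R M M :=
  Derivation.mk' ((D : M →ₗ[R] M) ^ p) (by
    intro f g
    have := iter_leibniz_p p hp D f g
    simp only [Module.End.pow_apply, smul_eq_mul]
    exact this)

lemma iterP_apply (p : ℕ) (hp : p.Prime) [CharP M p] (D : Derivation R M M) (f : M) :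
    iterP p hp D f = D^[p] f := by
  show ((D : M →ₗ[R] M) ^ p) f = _
  rw [Module.End.pow_apply]; rfl

end CharP

section SL2

variable {R M : Type*} [CommRing R] [CommRing M] [Algebra R M]
  (D H δ : Derivation R M M)
  (hHD : ∀ f, H (D f) = D (H f) + 2 * D f)
  (hδD : ∀ f, δ (D f) = D (δ f) + H f)

include hHD in
lemma H_iter (k : M) (hk : D k = 0) (f : M) (hf : H f = k * f) (n : ℕ) :
    H (D^[n] f) = (k + 2 * n) * D^[n] f := by
  induction n with
  | zero => simpa using hf
  | succ n ih =>
    rw [Function.iterate_succ_apply', hHD, ih]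
    simp only [Derivation.leibniz, map_add, hk, Derivation.map_natCast, smul_eq_mul]
    have : D (2:M) = 0 := by exact_mod_cast D.map_natCast 2
    rw [this]; push_cast; ring

include hHD hδD in
lemma δ_iter (k : M) (hk : D k = 0) (f : M) (hf : H f = k * f) (n : ℕ) :
    δ (D^[n+1] f) = D^[n+1] (δ f) + (n + 1) * (k + n) * D^[n] f := by
  induction n with
  | zero => simp [hδD, hf]
  | succ n ih =>
    rw [Function.iterate_succ_apply', hδD, ih, H_iter D H hHD k hk f hf, map_add,
      ← Function.iterate_succ_apply' D]
    have : D (D^[n] f) = D^[n+1] f := (Function.iterate_succ_apply' D n f).symm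
    have h1 : D (1:M) = 0 := by simp
    simp only [Derivation.leibniz, map_add, hk, Derivation.map_natCast, smul_eq_mul, this, h1]
    push_cast; ring

/-- coefficients of the expansion of `L^j f` -/
def cf (k j i : ℕ) : ℕ := j.choose i * (k + i).ascFactorial (j - i)

lemma cf_zero_of_lt {k j i : ℕ} (h : j < i) : cf k j i = 0 := by
  simp [cf, Nat.choose_eq_zero_of_lt h]

lemma cf_succ_zero (k j : ℕ) : cf k (j+1) 0 = k * cf k j 0 + k * cf k j 1 := by
  rcases j with _ | j
  · simp [cf, Nat.ascFactorial]
  · simp only [cf, Nat.choose_zero_right, Nat.choose_one_right, Nat.sub_zero, Nat.add_zero,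
      Nat.add_sub_cancel]
    have h1 := Nat.succ_ascFactorial k (j+1)
    have h2 := Nat.succ_ascFactorial k j
    have e1 : k.ascFactorial (j+1+1) = (k+(j+1)) * k.ascFactorial (j+1) := Nat.ascFactorial_succ
    have e2 : k.ascFactorial (j+1) = (k+j) * k.ascFactorial j := Nat.ascFactorial_succ
    rw [e1, e2] at *
    simp only [Nat.succ_eq_add_one] at *
    nlinarith

lemma cf_succ_succ (k j i : ℕ) : cf k (j+1) (i+1) =
    cf k j i + (k + 2 * (i + 1)) * cf k j (i+1) + (i+2) * (k+i+1) * cf k j (i+2) := by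
  rcases lt_or_ge j i with h | h
  · simp [cf_zero_of_lt, h, show j < i+1 by omega, show j < i+2 by omega]
  obtain ⟨d, rfl⟩ := Nat.exists_eq_add_of_le h
  rcases d with _ | d
  · simp [cf, Nat.choose_eq_zero_of_lt (show i < i + 2 by omega)]
  have a1 : (i + (d+1)).choose (i+1) * (i+1) = (i + (d+1)).choose i * (d+1) := by
    have := Nat.choose_succ_right_eq (i+(d+1)) i
    rwa [Nat.add_sub_cancel_left] at this
  have a2 : (i + (d+1)).choose (i+2) * (i+2) = (i + (d+1)).choose (i+1) * d := by
    have := Nat.choose_succ_right_eq (i+(d+1)) (i+1)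
    rwa [show i + (d+1) - (i+1) = d by omega] at this
  have a3 : (i + (d+1) + 1).choose (i+1) = (i + (d+1)).choose i + (i + (d+1)).choose (i+1) :=
    Nat.choose_succ_succ _ _
  have s1 : i + (d+1) + 1 - (i+1) = d + 1 := by omega
  have s2 : i + (d+1) - i = d + 1 := by omega
  have s3 : i + (d+1) - (i+1) = d := by omega
  have b1 : (k + (i+1)).ascFactorial (d+1) = (k+(i+1)+d) * (k + (i+1)).ascFactorial d :=
    Nat.ascFactorial_succ
  have b2 : (k + i).ascFactorial (d+1) = (k+i) * (k+(i+1)).ascFactorial d := by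
    have := Nat.succ_ascFactorial (k+i) d
    rw [show (k+i).succ = k+(i+1) by omega] at this
    rw [Nat.ascFactorial_succ, ← this]
  have b3 : (k+i+1) * cf k (i+(d+1)) (i+2) * (i+2)
      = (i + (d+1)).choose (i+1) * d * (k + (i+1)).ascFactorial d := by
    rw [← a2]
    rcases d with _ | d
    · simp [cf]
    · simp only [cf]
      have := Nat.succ_ascFactorial (k+i+1) d
      rw [show (k+i+1).succ = k+(i+2) by omega] at this
      rw [show i + (d+1+1) - (i+2) = d by omega, show k + (i+1) = k+i+1 by ring,
        Nat.ascFactorial_succ, ← this]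
      ring
  rw [show (i+2) * (k+i+1) * cf k (i+(d+1)) (i+2) = (k+i+1) * cf k (i+(d+1)) (i+2) * (i+2) by ring,
    b3]
  simp only [cf, s1, s2, s3, a3, b1, b2]
  zify at *
  linear_combination (-((k + (i+1)).ascFactorial d : ℤ)) * a1

variable (L : Derivation R M M) (A e : M)
  (hL : ∀ f, L f = A ^ 2 * D f + A * e * H f + e ^ 2 * δ f) (hLA : L A = 0) (hLe : L e = 0)

include hHD hδD hL hLA hLe in
lemma L_iter (k : ℕ) (f : M) (hf : H f = k * f) (hδ : δ f = 0) (j N : ℕ) (hN : j < N) :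
    L^[j] f = ∑ i ∈ Finset.range N, (cf k j i : M) * (A ^ (j + i) * e ^ (j - i) * D^[i] f) := by
  induction j generalizing N with
  | zero =>
    obtain ⟨N, rfl⟩ : ∃ n, N = n + 1 := ⟨N - 1, by omega⟩
    rw [Finset.sum_range_succ', Finset.sum_eq_zero]
    · simp [cf]
    · intro i _
      rw [cf_zero_of_lt (by omega)]; simp
  | succ j ih =>
    obtain ⟨N, rfl⟩ : ∃ n, N = n + 1 := ⟨N - 1, by omega⟩
    have hk : D (k : M) = 0 := D.map_natCast k
    have hd0 : ∀ n, D^[n] (0:M) = 0 := fun n => by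
      induction n with
      | zero => rfl
      | succ n ih => rw [Function.iterate_succ_apply, map_zero, ih]
    set W : ℕ → M := fun i => A ^ (j + 1 + i) * e ^ (j + 1 - i) * D^[i] f with hW
    have hLpow : ∀ a b, L (A ^ a * e ^ b) = 0 := by
      intro a b
      simp [Derivation.leibniz, Derivation.leibniz_pow, hLA, hLe]
    have t0 : (cf k j 0 : M) * L (A ^ (j + 0) * e ^ (j - 0) * D^[0] f)
        = cf k j 0 * W 1 + cf k j 0 * (k * W 0) := by
      rw [Derivation.leibniz, hLpow]
      simp only [hW, hL, Function.iterate_zero, id, hf, hδ, Function.iterate_one, smul_eq_mul]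
      rw [show j + 1 - 1 = j - 0 by omega]
      simp only [Nat.sub_zero, Nat.add_zero]
      ring
    have t1 : ∀ i, (cf k j (i+1) : M) * L (A ^ (j + (i+1)) * e ^ (j - (i+1)) * D^[i+1] f)
        = cf k j (i+1) * W (i+2) + cf k j (i+1) * ((k + 2 * (i+1)) * W (i+1))
          + cf k j (i+1) * ((i + 1) * (k + i) * W i) := by
      intro i
      rcases lt_or_ge j (i+1) with h | h
      · simp [cf_zero_of_lt h]
      rw [Derivation.leibniz, hLpow, hL, δ_iter D H δ hHD hδD k hk f hf, hδ, hd0,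
        H_iter D H hHD k hk f hf, ← Function.iterate_succ_apply' D]
      simp only [hW, smul_eq_mul]
      obtain ⟨d, rfl⟩ := Nat.exists_eq_add_of_le h
      rw [show i + 1 + d + 1 - (i + 2) = d by omega, show i + 1 + d + 1 - (i + 1) = d + 1 by omega,
        show i + 1 + d + 1 - i = d + 2 by omega, show i + 1 + d - (i + 1) = d by omega]
      push_cast
      ring
    rw [Function.iterate_succ_apply', ih (N+2) (by omega), map_sum]
    have hcf : ∀ i, L ((cf k j i : M) * (A ^ (j + i) * e ^ (j - i) * D^[i] f))
        = (cf k j i : M) * L (A ^ (j + i) * e ^ (j - i) * D^[i] f) := by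
      intro i
      rw [Derivation.leibniz, Derivation.map_natCast]; simp
    simp_rw [hcf]
    rw [Finset.sum_range_succ', t0]
    simp_rw [t1]
    rw [Finset.sum_add_distrib, Finset.sum_add_distrib]
    have r1 : ∑ i ∈ Finset.range (N+1), (cf k j (i+1) : M) * W (i+2) + cf k j 0 * W 1
        = ∑ i ∈ Finset.range N, (cf k j i : M) * W (i+1) := by
      rw [← Finset.sum_range_succ' (fun i => (cf k j i : M) * W (i+1)), Finset.sum_range_succ,
        Finset.sum_range_succ, cf_zero_of_lt (show j < N by omega),
        cf_zero_of_lt (show j < N + 1 by omega)]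
      simp
    have r2 : ∑ i ∈ Finset.range (N+1), (cf k j (i+1) : M) * ((k + 2 * (i+1)) * W (i+1))
        = ∑ i ∈ Finset.range N, (cf k j (i+1) : M) * ((k + 2 * (i+1)) * W (i+1)) := by
      rw [Finset.sum_range_succ, cf_zero_of_lt (show j < N + 1 by omega)]
      simp
    have r3 : ∑ i ∈ Finset.range (N+1), (cf k j (i+1) : M) * ((i + 1) * (k + i) * W i)
        = ∑ i ∈ Finset.range N, (cf k j (i+2) : M) * ((i + 2) * (k + i + 1) * W (i+1))
          + cf k j 1 * (k * W 0) := by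
      rw [Finset.sum_range_succ']
      congr 1
      · refine Finset.sum_congr rfl fun i _ => ?_
        push_cast; ring
      · push_cast; ring
    have g1 : ∑ i ∈ Finset.range (N+1), (cf k (j+1) i : M) * W i
        = ∑ i ∈ Finset.range N, (cf k (j+1) (i+1) : M) * W (i+1) + cf k (j+1) 0 * W 0 :=
      Finset.sum_range_succ' _ _
    have g2 : ∑ i ∈ Finset.range N, (cf k (j+1) (i+1) : M) * W (i+1)
        = ∑ i ∈ Finset.range N, (cf k j i : M) * W (i+1)
        + ∑ i ∈ Finset.range N, (cf k j (i+1) : M) * ((k + 2 * (i+1)) * W (i+1))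
        + ∑ i ∈ Finset.range N, (cf k j (i+2) : M) * ((i + 2) * (k + i + 1) * W (i+1)) := by
      rw [← Finset.sum_add_distrib, ← Finset.sum_add_distrib]
      refine Finset.sum_congr rfl fun i _ => ?_
      rw [cf_succ_succ]
      push_cast; ring
    have g3 : (cf k (j+1) 0 : M) = k * cf k j 0 + k * cf k j 1 := by
      rw [cf_succ_zero]; push_cast; ring
    change _ = ∑ i ∈ Finset.range (N+1), (cf k (j+1) i : M) * W i
    rw [g1, g2, g3]
    linear_combination r1 + r2 + r3

include hHD hδD hL hLA hLe in
lemma A_dvd_L_iter (p : ℕ) (hp : p.Prime) [CharP M p] (k : ℕ) (hk2 : 2 ≤ k) (hkp : k ≤ p)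
    (f : M) (hf : H f = k * f) (hδ : δ f = 0) : A ^ p ∣ L^[p-1] f := by
  have hp1 := hp.two_le
  rw [L_iter D H δ hHD hδD L A e hL hLA hLe k f hf hδ (p-1) p (by omega)]
  refine Finset.dvd_sum fun i _ => ?_
  rcases i with _ | i
  · have : ((cf k (p-1) 0 : ℕ) : M) = 0 := by
      rw [CharP.cast_eq_zero_iff M p]
      simp only [cf, Nat.choose_zero_right, one_mul, Nat.sub_zero, Nat.add_zero,
        Nat.ascFactorial_eq_prod_range]
      have := Finset.dvd_prod_of_mem (fun i => k + i)
        (show p - k ∈ Finset.range (p-1) from Finset.mem_range.mpr (by omega))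
      simpa [Nat.add_sub_cancel' hkp] using this
    rw [this]; simp
  · rw [show p - 1 + (i+1) = p + i by omega, pow_add]
    exact ⟨(cf k (p-1) (i+1) : M) * (A ^ i * e ^ (p - 1 - (i+1)) * D^[i+1] f), by ring⟩

end SL2

section Concrete

/-- Polynomials in `P, Q, R` over a ring. -/
abbrev M3 (R : Type*) [CommRing R] : Type _ := MvPolynomial (Fin 3) R

/-- The Ramanujan derivation over a ring with `12 t = 1`. -/
def DR (R : Type*) [CommRing R] (t : R) : Derivation R (M3 R) (M3 R) :=
  (C t * (X 0 ^ 2 - X 1) : M3 R) • pderiv 0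
    + (C (4 * t) * (X 0 * X 1 - X 2) : M3 R) • pderiv 1
    + (C (6 * t) * (X 0 * X 2 - X 1 ^ 2) : M3 R) • pderiv 2

/-- The Euler derivation. -/
def HR (R : Type*) [CommRing R] : Derivation R (M3 R) (M3 R) :=
  (2 * X 0 : M3 R) • pderiv 0 + (4 * X 1 : M3 R) • pderiv 1 + (6 * X 2 : M3 R) • pderiv 2

/-- The lowering derivation `12 ∂/∂P`. -/
def δR (R : Type*) [CommRing R] : Derivation R (M3 R) (M3 R) :=
  (12 : M3 R) • pderiv 0

variable {R : Type*} [CommRing R] (t : R)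

lemma DR_X0 : DR R t (X 0) = C t * (X 0 ^ 2 - X 1) := by simp [DR, pderiv_X]
lemma DR_X1 : DR R t (X 1) = C (4 * t) * (X 0 * X 1 - X 2) := by simp [DR, pderiv_X]
lemma DR_X2 : DR R t (X 2) = C (6 * t) * (X 0 * X 2 - X 1 ^ 2) := by simp [DR, pderiv_X]
lemma HR_X0 : HR R (X 0) = 2 * X 0 := by simp [HR, pderiv_X]
lemma HR_X1 : HR R (X 1) = 4 * X 1 := by simp [HR, pderiv_X]
lemma HR_X2 : HR R (X 2) = 6 * X 2 := by simp [HR, pderiv_X]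
lemma δR_X0 : δR R (X 0) = 12 := by simp [δR, pderiv_X]
lemma δR_X1 : δR R (X 1) = 0 := by simp [δR, pderiv_X]
lemma δR_X2 : δR R (X 2) = 0 := by simp [δR, pderiv_X]

lemma der_2 (D : Derivation R (M3 R) (M3 R)) : D (2 : M3 R) = 0 := by
  exact_mod_cast D.map_natCast 2

lemma der_4 (D : Derivation R (M3 R) (M3 R)) : D (4 : M3 R) = 0 := by
  exact_mod_cast D.map_natCast 4

lemma der_6 (D : Derivation R (M3 R) (M3 R)) : D (6 : M3 R) = 0 := by
  exact_mod_cast D.map_natCast 6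

lemma der_12 (D : Derivation R (M3 R) (M3 R)) : D (12 : M3 R) = 0 := by
  exact_mod_cast D.map_natCast 12

lemma bracket_HD (f : M3 R) :
    HR R (DR R t f) = DR R t (HR R f) + 2 * DR R t f := by
  have h : ⁅HR R, DR R t⁆ = (2 : M3 R) • DR R t := by
    apply MvPolynomial.derivation_ext
    intro i
    rw [Derivation.commutator_apply]
    fin_cases i <;>
    simp only [Fin.zero_eta, Fin.mk_one, Fin.reduceFinMk, Derivation.smul_apply, DR_X0, DR_X1,
      DR_X2, HR_X0, HR_X1, HR_X2, Derivation.leibniz, Derivation.leibniz_pow, map_sub,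
      derivation_C, der_2, der_4, der_6, der_12, smul_eq_mul, nsmul_eq_mul] <;>
    push_cast <;> ring
  have := congrArg (fun D => D f) h
  simp only [Derivation.commutator_apply, Derivation.smul_apply, smul_eq_mul] at this
  linear_combination this

lemma bracket_δD (ht : 12 * t = 1) (f : M3 R) :
    δR R (DR R t f) = DR R t (δR R f) + HR R f := by
  have h1 : (12 : M3 R) * C t = 1 := by
    rw [← map_ofNat C 12, ← map_mul, ht, map_one]
  have h4 : (C (4 * t) : M3 R) = 4 * C t := by rw [map_mul, map_ofNat]
  have h6 : (C (6 * t) : M3 R) = 6 * C t := by rw [map_mul, map_ofNat]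
  have h : ⁅δR R, DR R t⁆ = HR R := by
    apply MvPolynomial.derivation_ext
    intro i
    rw [Derivation.commutator_apply]
    fin_cases i <;>
    simp only [Fin.zero_eta, Fin.mk_one, Fin.reduceFinMk, Derivation.smul_apply, DR_X0, DR_X1,
      DR_X2, HR_X0, HR_X1, HR_X2, δR_X0, δR_X1, δR_X2, Derivation.leibniz,
      Derivation.leibniz_pow, map_sub, map_zero, h4, h6,
      derivation_C, der_2, der_4, der_6, der_12, smul_eq_mul, nsmul_eq_mul] <;>
    push_cast
    · linear_combination 2 * X 0 * h1
    · linear_combination 4 * X 1 * h1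
    · linear_combination 6 * X 2 * h1
  have := congrArg (fun D => D f) h
  simp only [Derivation.commutator_apply] at this
  linear_combination this

/-- isobaric of weight `n`, with integer weights. -/
def Wt (n : ℤ) (f : M3 R) : Prop := IsWeightedHomogeneous (![2, 4, 6] : Fin 3 → ℤ) f n

lemma wt_iff (n : ℤ) (f : M3 R) :
    Wt n f ↔ ∀ m ∈ f.support, (2 * m 0 + 4 * m 1 + 6 * m 2 : ℤ) = n := by
  unfold Wt IsWeightedHomogeneous
  have : ∀ m : Fin 3 →₀ ℕ, Finsupp.weight (![2, 4, 6] : Fin 3 → ℤ) m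
      = (2 * m 0 + 4 * m 1 + 6 * m 2 : ℤ) := by
    intro m
    rw [Finsupp.weight_apply, Finsupp.sum_fintype _ _ (by simp)]
    simp [Fin.sum_univ_three]; ring
  simp [this, mem_support_iff]

lemma wt_X0 : Wt 2 (X 0 : M3 R) := isWeightedHomogeneous_X R _ 0
lemma wt_X1 : Wt 4 (X 1 : M3 R) := isWeightedHomogeneous_X R _ 1
lemma wt_X2 : Wt 6 (X 2 : M3 R) := isWeightedHomogeneous_X R _ 2
lemma Wt.mul {m n : ℤ} {f g : M3 R} (hf : Wt m f) (hg : Wt n g) : Wt (m + n) (f * g) :=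
  IsWeightedHomogeneous.mul hf hg
lemma Wt.cast {m n : ℤ} {f : M3 R} (hf : Wt m f) (h : m = n) : Wt n f := h ▸ hf
lemma Wt.add {n : ℤ} {f g : M3 R} (hf : Wt n f) (hg : Wt n g) : Wt n (f + g) :=
  IsWeightedHomogeneous.add hf hg
lemma Wt.sub {n : ℤ} {f g : M3 R} (hf : Wt n f) (hg : Wt n g) : Wt n (f - g) :=
  IsWeightedHomogeneous.sub hf hg
lemma Wt.C_mul {n : ℤ} {f : M3 R} (hf : Wt n f) (r : R) : Wt n (C r * f) :=
  IsWeightedHomogeneous.C_mul hf r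
lemma Wt.pow {n : ℤ} {f : M3 R} (hf : Wt n f) (k : ℕ) : Wt (k * n) (f ^ k) := by
  have := IsWeightedHomogeneous.pow hf k
  simpa [nsmul_eq_mul] using! this

lemma Wt.DR {n : ℤ} {f : M3 R} (hf : Wt n f) : Wt (n + 2) (DR R t f) := by
  have h0 : Wt (n - 2) (pderiv 0 f) := IsWeightedHomogeneous.pderiv hf (by simp)
  have h1 : Wt (n - 4) (pderiv 1 f) := IsWeightedHomogeneous.pderiv hf (by simp)
  have h2 : Wt (n - 6) (pderiv 2 f) := IsWeightedHomogeneous.pderiv hf (by simp)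
  have e : _root_.DR R t f = C t * (X 0 ^ 2 - X 1) * pderiv 0 f
    + C (4 * t) * (X 0 * X 1 - X 2) * pderiv 1 f
    + C (6 * t) * (X 0 * X 2 - X 1 ^ 2) * pderiv 2 f := by
    simp [_root_.DR]
  rw [e]
  refine ((Wt.mul (Wt.C_mul (n := 4) (((wt_X0.pow 2).cast (by norm_num)).sub wt_X1) t) h0).cast
    (by ring)).add ?_ |>.add ?_
  · exact (Wt.mul (Wt.C_mul (((wt_X0.mul wt_X1).cast (by norm_num)).sub wt_X2) _) h1).cast
      (by ring)
  · exact (Wt.mul (Wt.C_mul (n := 8) (((wt_X0.mul wt_X2).cast (by norm_num)).sub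
      ((wt_X1.pow 2).cast (by norm_num))) _) h2).cast (by ring)

lemma Wt.DR_iter {n : ℤ} {f : M3 R} (hf : Wt n f) (k : ℕ) :
    Wt (n + 2 * k) ((_root_.DR R t)^[k] f) := by
  induction k with
  | zero => simpa using hf
  | succ k ih =>
    rw [Function.iterate_succ_apply']
    exact (ih.DR t).cast (by push_cast; ring)

lemma Wt.HR {n : ℤ} {f : M3 R} (hf : Wt n f) : HR R f = (n : M3 R) * f := by
  rw [wt_iff] at hf
  have key : ∀ (m : Fin 3 →₀ ℕ) (r : R),
      _root_.HR R (monomial m r) = ((2 * m 0 + 4 * m 1 + 6 * m 2 : ℤ) : M3 R) * monomial m r := by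
    intro m r
    have h0 := X_mul_pderiv_monomial (i := (0 : Fin 3)) (m := m) (r := r)
    have h1 := X_mul_pderiv_monomial (i := (1 : Fin 3)) (m := m) (r := r)
    have h2 := X_mul_pderiv_monomial (i := (2 : Fin 3)) (m := m) (r := r)
    rw [nsmul_eq_mul] at h0 h1 h2
    simp only [_root_.HR, Derivation.add_apply, Derivation.smul_apply, smul_eq_mul]
    push_cast
    linear_combination 2 * h0 + 4 * h1 + 6 * h2
  conv_lhs => rw [f.as_sum]
  conv_rhs => rw [f.as_sum]
  rw [map_sum, Finset.mul_sum]
  refine Finset.sum_congr rfl fun m hm => ?_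
  rw [key, hf m hm]

/-- The map `Φ` over a ring. -/
def PhiR (R : Type*) [CommRing R] : M3 R →ₐ[R] PowerSeries R :=
  aeval ![eisR R (-24) 1, eisR R 240 3, eisR R (-504) 5]

lemma PhiR_DR (ht : 12 * t = 1) (f : M3 R) : PhiR R (DR R t f) = thetaD R (PhiR R f) := by
  have hp : ∀ i : Fin 3, PhiR R (DR R t (X i)) = thetaD R (PhiR R (X i)) := by
    have h1 : (12 : PowerSeries R) * algebraMap R _ t = 1 := by
      rw [← map_ofNat (algebraMap R (PowerSeries R)) 12, ← map_mul, ht, map_one]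
    have h4 : (C (4 * t) : M3 R) = 4 * C t := by rw [map_mul, map_ofNat]
    have h6 : (C (6 * t) : M3 R) = 6 * C t := by rw [map_mul, map_ofNat]
    have hC : PhiR R (C t) = algebraMap R _ t := by
      rw [← algebraMap_eq]; exact (PhiR R).commutes t
    have v0 : PhiR R (X 0) = eisR R (-24) 1 := by simp [PhiR]
    have v1 : PhiR R (X 1) = eisR R 240 3 := by simp [PhiR]
    have v2 : PhiR R (X 2) = eisR R (-504) 5 := by simp [PhiR]
    intro i
    fin_cases i <;> simp only [Fin.zero_eta, Fin.mk_one, Fin.reduceFinMk, DR_X0, DR_X1, DR_X2,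
      h4, h6, map_mul, map_sub, map_pow, hC, v0, v1, v2, map_ofNat]
    · linear_combination (-algebraMap R (PowerSeries R) t) * ram2 R
        + thetaD R (eisR R (-24) 1) * h1
    · linear_combination (-4*algebraMap R (PowerSeries R) t) * ram4 R
        + thetaD R (eisR R 240 3) * h1
    · linear_combination (-6*algebraMap R (PowerSeries R) t) * ram6 R
        + thetaD R (eisR R (-504) 5) * h1
  induction f using MvPolynomial.induction_on with
  | C a => 
    rw [derivation_C, ← algebraMap_eq, AlgHom.commutes, Derivation.map_algebraMap, map_zero]
  | add f g hf hg => simp only [map_add, hf, hg]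
  | mul_X f i hf =>
    simp only [Derivation.leibniz, map_add, map_mul, smul_eq_mul, hf, hp]

lemma PhiR_map {S : Type*} [CommRing S] (φ : R →+* S) (f : M3 R) :
    PhiR S (MvPolynomial.map φ f) = PowerSeries.map φ (PhiR R f) := by
  have he : ∀ c j, PowerSeries.map φ (eisR R c j) = eisR S c j := by
    intro c j
    ext n
    simp only [eisR, PowerSeries.coeff_map]; simp
  induction f using MvPolynomial.induction_on with
  | C a =>
    rw [map_C, ← algebraMap_eq, ← algebraMap_eq, AlgHom.commutes, AlgHom.commutes]
    simp [PowerSeries.algebraMap_apply]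
  | add f g hf hg => simp only [map_add, hf, hg]
  | mul_X f i hf =>
    rw [map_mul, map_mul, map_mul, map_mul, hf, map_X]
    congr 1
    fin_cases i <;> simp [PhiR, he]

lemma DR_map {S : Type*} [CommRing S] (φ : R →+* S) (f : M3 R) :
    DR S (φ t) (MvPolynomial.map φ f) = MvPolynomial.map φ (DR R t f) := by
  simp [DR, pderiv_map, map_ofNat φ 4, map_ofNat φ 6]

end Concrete

section ModP

lemma ps_transc {K : Type*} [Field K] (s : PowerSeries K) (hs0 : PowerSeries.constantCoeff s = 1)
    (hs1 : s ≠ 1) (g : Polynomial K) (hg : Polynomial.aeval s g = 0) : g = 0 := by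
  by_contra hne
  obtain ⟨h, hh, hnd⟩ := g.exists_eq_pow_rootMultiplicity_mul_and_not_dvd hne 1
  rw [hh, map_mul, map_pow] at hg
  have h1 : Polynomial.aeval s (Polynomial.X - Polynomial.C (1:K)) ≠ 0 := by
    simpa [sub_eq_zero] using hs1
  have h2 : Polynomial.aeval s h = 0 := by
    rcases mul_eq_zero.mp hg with h' | h'
    · exact absurd (eq_zero_of_pow_eq_zero h') h1
    · exact h'
  apply hnd
  rw [Polynomial.dvd_iff_isRoot, Polynomial.IsRoot]
  have := congrArg PowerSeries.constantCoeff h2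
  rw [Polynomial.aeval_def, Polynomial.hom_eval₂, hs0, map_zero] at this
  have hc : (PowerSeries.constantCoeff (R := K)).comp (algebraMap K (PowerSeries K))
      = RingHom.id K := by
    ext x; simp [PowerSeries.algebraMap_apply]
  rw [hc] at this
  simpa [Polynomial.eval₂_id] using this

variable (p : ℕ) [Fact p.Prime] (hp5 : 5 ≤ p)

include hp5 in
lemma ne_zero_of_23 (a b : ℕ) : ((2 ^ a * 3 ^ b : ℕ) : ZMod p) ≠ 0 := by
  have hp : p.Prime := Fact.out
  rw [Ne, ZMod.natCast_eq_zero_iff, hp.dvd_mul]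
  rintro (h | h)
  · have := (Nat.prime_dvd_prime_iff_eq hp Nat.prime_two).mp (hp.dvd_of_dvd_pow h); omega
  · have := (Nat.prime_dvd_prime_iff_eq hp Nat.prime_three).mp (hp.dvd_of_dvd_pow h); omega

include hp5 in
lemma e4e6_ne : eisR (ZMod p) 240 3 ^ 3 ≠ eisR (ZMod p) (-504) 5 ^ 2 := by
  intro h
  have h1 := congrArg (PowerSeries.coeff 1) h
  rw [PowerSeries.coeff_one_pow, PowerSeries.coeff_one_pow, constCoeff_eisR, constCoeff_eisR] at h1
  have c4 : PowerSeries.coeff 1 (eisR (ZMod p) 240 3) = 240 := by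
    simp [eisR, eis]
  have c6 : PowerSeries.coeff 1 (eisR (ZMod p) (-504) 5) = -504 := by
    simp [eisR, eis]
  rw [c4, c6] at h1
  apply ne_zero_of_23 p hp5 6 3
  push_cast at h1 ⊢
  linear_combination h1

include hp5 in
lemma Phi_inj (N : ℕ) (f : M3 (ZMod p)) (hN : Wt (N : ℤ) f) (h0 : ∀ m ∈ f.support, m 0 = 0)
    (hΦ : PhiR (ZMod p) f = 0) : f = 0 := by
  rw [wt_iff] at hN
  set x := eisR (ZMod p) 240 3 with hx
  set y := eisR (ZMod p) (-504) 5 with hy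
  have hyc : PowerSeries.constantCoeff y = 1 := constCoeff_eisR _ _
  have hxc : PowerSeries.constantCoeff x = 1 := constCoeff_eisR _ _
  have hyi : y * y⁻¹ = 1 := PowerSeries.mul_inv_cancel y (by rw [hyc]; exact one_ne_zero)
  set s := x ^ 3 * y⁻¹ ^ 2 with hs
  have hsc : PowerSeries.constantCoeff s = 1 := by simp [hs, hxc, hyc]
  have hs1 : s ≠ 1 := by
    intro h
    apply e4e6_ne p hp5
    rw [← hx, ← hy]
    linear_combination y ^ 2 * h - x ^ 3 * (y * y⁻¹ + 1) * hyi
  set M := N / 2 with hM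
  set r := (2 * M) % 3 with hr
  set cc := (M - 2 * r) / 3 with hcc
  have harith : ∀ m ∈ f.support, m 1 = r + 3 * (m 1 / 3) ∧ m 2 + 2 * (m 1 / 3) = cc := by
    intro m hm
    have h1 := hN m hm
    have h2 := h0 m hm
    omega
  have hterm : ∀ m ∈ f.support, x ^ (m 1) * y ^ (m 2) = x ^ r * y ^ cc * s ^ (m 1 / 3) := by
    intro m hm
    obtain ⟨h1, h2⟩ := harith m hm
    have hy2 : y ^ (2 * (m 1 / 3)) * (y⁻¹ ^ 2) ^ (m 1 / 3) = 1 := by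
      rw [pow_mul, ← mul_pow, ← mul_pow, hyi]; simp
    conv_lhs => rw [h1]
    rw [hs, ← h2, mul_pow, ← pow_mul, pow_add, pow_add]
    linear_combination (-x ^ r * x ^ (3 * (m 1 / 3)) * y ^ m 2) * hy2
  have hev : PhiR (ZMod p) f = ∑ m ∈ f.support, (coeff m f) • (x ^ (m 1) * y ^ (m 2)) := by
    rw [PhiR, aeval_def, eval₂_eq']
    refine Finset.sum_congr rfl fun m hm => ?_
    rw [Fin.prod_univ_three, h0 m hm, Algebra.smul_def]
    simp [hx, hy]
  set g : Polynomial (ZMod p) := ∑ m ∈ f.support, Polynomial.monomial (m 1 / 3) (coeff m f) with hg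
  have hgs : Polynomial.aeval s g = 0 := by
    have : x ^ r * y ^ cc * Polynomial.aeval s g = 0 := by
      rw [← hΦ, hev, hg, map_sum, Finset.mul_sum]
      refine Finset.sum_congr rfl fun m hm => ?_
      rw [hterm m hm, Polynomial.aeval_monomial, Algebra.smul_def]
      ring
    rcases mul_eq_zero.mp this with h | h
    · exfalso
      have := congrArg PowerSeries.constantCoeff h
      simp [hxc, hyc] at this
    · exact h
  have hg0 := ps_transc s hsc hs1 g hgs
  by_contra hne
  obtain ⟨m, hm⟩ := support_nonempty.mpr hne
  have hc := congrArg (fun g => Polynomial.coeff g (m 1 / 3)) hg0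
  simp only [hg, Polynomial.finsetSum_coeff, Polynomial.coeff_monomial, Polynomial.coeff_zero] at hc
  rw [Finset.sum_eq_single m] at hc
  · simp at hc
    exact (mem_support_iff.mp hm) hc
  · intro m' hm' hmm
    rw [if_neg]
    intro h
    apply hmm
    have h1 := harith m hm
    have h2 := harith m' hm'
    have h3 := h0 m hm
    have h4 := h0 m' hm'
    ext i
    fin_cases i
    · simp [h3, h4]
    · simp; omega
    · simp; omega
  · intro h; exact absurd hm h

include hp5 in
lemma inj_I (N : ℕ) (hN : N = p + 3 ∨ N = 2 * p + 2) (f : M3 (ZMod p)) (hw : Wt (N : ℤ) f)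
    (hδ : δR (ZMod p) f = 0) (hΦ : PhiR (ZMod p) f = 0) : f = 0 := by
  have h12 : (12 : ZMod p) ≠ 0 := by
    have := ne_zero_of_23 p hp5 2 1
    norm_num at this; exact this
  have hd : pderiv 0 f = 0 := by
    have h : (C (12 : ZMod p)) * pderiv 0 f = 0 := by
      rw [map_ofNat C 12]; simpa [δR] using hδ
    rcases mul_eq_zero.mp h with h | h
    · exact absurd (C_eq_zero.mp h) h12
    · exact h
  refine Phi_inj p hp5 N f hw (fun m hm => ?_) hΦ
  by_contra h0
  have hc := congrArg (coeff (m - Finsupp.single 0 1)) hd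
  rw [coeff_pderiv] at hc
  have hm' : m - Finsupp.single 0 1 + Finsupp.single 0 1 = m := by
    apply tsub_add_cancel_of_le
    rw [Finsupp.single_le_iff]; omega
  rw [hm', coeff_zero] at hc
  have hmz : ((m 0 : ℕ) : ZMod p) = 0 := by
    rcases mul_eq_zero.mp hc with h | h
    · exact absurd h (mem_support_iff.mp hm)
    · have : m 0 = (m - Finsupp.single 0 1 : Fin 3 →₀ ℕ) 0 + 1 := by
        simp; omega
      rw [this]; push_cast; exact h
  rw [ZMod.natCast_eq_zero_iff] at hmz
  have hwt := (wt_iff _ _).mp hw m hm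
  obtain ⟨c, hc⟩ := hmz
  rcases c with _ | _ | c
  · omega
  · rw [zero_add, mul_one] at hc; omega
  · have : 2 * p ≤ m 0 := by rw [hc]; nlinarith
    omega


lemma theta_iter (a : PowerSeries (ZMod p)) : (thetaD (ZMod p))^[p] a = thetaD (ZMod p) a := by
  have h : ∀ k n, PowerSeries.coeff n ((thetaD (ZMod p))^[k] a)
      = (n : ZMod p) ^ k * PowerSeries.coeff n a := by
    intro k
    induction k with
    | zero => simp
    | succ k ih =>
      intro n
      rw [Function.iterate_succ_apply', coeff_thetaD, ih]; ring
  ext n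
  rw [h, ZMod.pow_card, coeff_thetaD]

include hp5 in
theorem modp_main (t : ZMod p) (ht : 12 * t = 1) (A : M3 (ZMod p)) (hA : Wt ((p : ℤ) - 1) A)
    (hδA : δR (ZMod p) A = 0) (hΦA : PhiR (ZMod p) A = 1) (k : ℕ) (hk2 : 2 ≤ k) (hkp : k ≤ p)
    (f : M3 (ZMod p)) (hf : Wt (k : ℤ) f) (hδf : δR (ZMod p) f = 0) :
    A ^ p ∣ (DR (ZMod p) t)^[p ^ 2 - p] f := by
  have hp : p.Prime := Fact.out
  set D := DR (ZMod p) t with hD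
  set H := HR (ZMod p) with hH
  set δ := δR (ZMod p) with hδ
  set L := iterP p hp D with hL
  have hp0 : (p : M3 (ZMod p)) = 0 := CharP.cast_eq_zero _ p
  have hHD : ∀ f, H (D f) = D (H f) + 2 * D f := bracket_HD t
  have hδD : ∀ f, δ (D f) = D (δ f) + H f := bracket_δD t ht
  have hΦD : ∀ f, PhiR (ZMod p) (D f) = thetaD _ (PhiR (ZMod p) f) := PhiR_DR t ht
  have hHA : H A = -A := by rw [hA.HR]; push_cast; rw [hp0]; ring
  set e := D A with he
  have hew : Wt ((p : ℤ) + 1) e := (hA.DR t).cast (by ring)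
  have hHe : H e = e := by rw [hew.HR]; push_cast; rw [hp0]; ring
  have hδe : δ e = -A := by rw [he, hδD, hδA, map_zero, hHA]; ring
  have hΦe : PhiR (ZMod p) e = 0 := by rw [he, hΦD, hΦA]; simp
  have hDe : D e = 0 := by
    refine inj_I p hp5 (p + 3) (Or.inl rfl) _ ((hew.DR t).cast (by push_cast; ring)) ?_ ?_
    · change δ (D e) = 0
      rw [hδD, hδe, hHe, map_neg, ← he]; ring
    · rw [hΦD, hΦe, map_zero]
  let Λ : Derivation (ZMod p) (M3 (ZMod p)) (M3 (ZMod p)) :=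
    (A ^ 2) • D + (A * e) • H + (e ^ 2) • δ
  have hΛ : ∀ f, Λ f = A ^ 2 * D f + A * e * H f + e ^ 2 * δ f := fun f => rfl
  have hδ0 : δ (X 0) = 12 := δR_X0
  have hH0 : H (X 0) = 2 * X 0 := HR_X0
  have hd0 : ∀ n, D^[n] (0 : M3 (ZMod p)) = 0 := fun n => by
    induction n with
    | zero => rfl
    | succ n ih => rw [Function.iterate_succ_apply, map_zero, ih]
  have hLP : L (X 0) = Λ (X 0) := by
    rw [← sub_eq_zero]
    refine inj_I p hp5 (2 * p + 2) (Or.inr rfl) _ ?_ ?_ ?_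
    · refine Wt.sub ?_ ?_
      · rw [hL, iterP_apply]
        exact (wt_X0.DR_iter t p).cast (by push_cast; ring)
      · rw [hΛ, hH0, hδ0]
        have w1 : Wt ((2 * p + 2 : ℕ) : ℤ) (A ^ 2 * D (X 0)) :=
          ((hA.pow 2).mul (wt_X0.DR t)).cast (by push_cast; ring)
        have w2 : Wt ((2 * p + 2 : ℕ) : ℤ) (A * e * (C 2 * X 0)) :=
          ((hA.mul hew).mul (wt_X0.C_mul 2)).cast (by push_cast; ring)
        have w3 : Wt ((2 * p + 2 : ℕ) : ℤ) (C 12 * e ^ 2) :=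
          ((hew.pow 2).C_mul 12).cast (by push_cast; ring)
        rw [map_ofNat C 2] at w2
        rw [map_ofNat C 12, mul_comm (12 : M3 (ZMod p)) (e ^ 2)] at w3
        exact (w1.add w2).add w3
    · change δ (L (X 0) - Λ (X 0)) = 0
      have h1 : δ (L (X 0)) = 0 := by
        rw [hL, iterP_apply]
        obtain ⟨q, hq⟩ : ∃ q, p = q + 1 := ⟨p - 1, by omega⟩
        have := δ_iter D H δ hHD hδD 2 (der_2 D) (X 0) hH0 q
        rw [← hq, hδ0] at this
        have hq0 : (q : M3 (ZMod p)) + 1 = 0 := by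
          have h := (CharP.cast_eq_zero_iff (M3 (ZMod p)) p (q + 1)).mpr (by rw [← hq])
          push_cast at h; exact h
        have h12 : ∀ m, m = q + 1 → D^[m] (12 : M3 (ZMod p)) = 0 := by
          rintro _ rfl
          rw [Function.iterate_succ_apply, der_12, hd0]
        rw [this, hq0, h12 p hq]; ring
      have h2 : δ (Λ (X 0)) = 0 := by
        rw [hΛ, hH0, hδ0]
        simp only [map_add, Derivation.leibniz, Derivation.leibniz_pow, hδD, hδA, hδe, hδ0, hH0,
          der_12, der_2, smul_eq_mul, nsmul_eq_mul, smul_zero]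
        push_cast
        ring
      rw [map_sub, h1, h2, sub_zero]
    · rw [map_sub, hΛ]
      simp only [map_add, map_mul, map_pow, hΦA, hΦe, hΦD]
      have : ∀ n g, PhiR (ZMod p) (D^[n] g) = (thetaD (ZMod p))^[n] (PhiR (ZMod p) g) := by
        intro n g
        induction n with
        | zero => rfl
        | succ n ih => rw [Function.iterate_succ_apply', hΦD, ih, Function.iterate_succ_apply']
      rw [hL, iterP_apply, this, theta_iter]
      ring
  have hDΛ : ∀ g, D (Λ g) = Λ (D g) := by
    intro g
    rw [hΛ, hΛ]
    simp only [map_add, Derivation.leibniz, Derivation.leibniz_pow, hδD, hHD, hDe, ← he,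
      smul_eq_mul, nsmul_eq_mul]
    push_cast
    ring
  have hDL : ∀ g, D (L g) = L (D g) := by
    intro g
    rw [hL, iterP_apply, iterP_apply, ← Function.iterate_succ_apply' D,
      Function.iterate_succ_apply]
  have hX1 : (X 1 : M3 (ZMod p)) = X 0 ^ 2 - 12 * D (X 0) := by
    have h1 : (12 : M3 (ZMod p)) * C t = 1 := by
      rw [← map_ofNat C 12, ← map_mul, ht, map_one]
    rw [hD, DR_X0]; linear_combination (X 0 ^ 2 - X 1) * h1
  have hX2 : (X 2 : M3 (ZMod p)) = X 0 * X 1 - 3 * D (X 1) := by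
    have h1 : (12 : M3 (ZMod p)) * C t = 1 := by
      rw [← map_ofNat C 12, ← map_mul, ht, map_one]
    rw [hD, DR_X1, map_mul, map_ofNat]; linear_combination (X 0 * X 1 - X 2) * h1
  have der_3 : ∀ D : Derivation (ZMod p) (M3 (ZMod p)) (M3 (ZMod p)), D 3 = 0 := by
    intro D; exact_mod_cast D.map_natCast 3
  have h1 : L (X 1) = Λ (X 1) := by
    rw [hX1]
    simp only [map_sub, Derivation.leibniz, Derivation.leibniz_pow, ← hDΛ, ← hDL, hLP, der_12]
  have h2 : L (X 2) = Λ (X 2) := by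
    rw [hX2]
    simp only [map_sub, Derivation.leibniz, Derivation.leibniz_pow, ← hDΛ, ← hDL, hLP, h1, der_3]
  have hLΛ : L = Λ := by
    apply MvPolynomial.derivation_ext
    intro i
    fin_cases i
    · exact hLP
    · exact h1
    · exact h2
  have hLf : ∀ f, L f = A ^ 2 * D f + A * e * H f + e ^ 2 * δ f := by
    intro f; rw [hLΛ, hΛ]
  have hLA : L A = 0 := by rw [hLf, hHA, hδA, ← he]; ring
  have hLe : L e = 0 := by rw [hLf, hDe, hHe, hδe]; ring
  have := A_dvd_L_iter D H δ hHD hδD L A e hLf hLA hLe p hp k hk2 hkp f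
    (by rw [hf.HR]; push_cast; rfl) hδf
  have hiter : (L : M3 (ZMod p) → M3 (ZMod p)) = D^[p] := by
    ext1 g; rw [hL, iterP_apply]
  rwa [hiter, ← Function.iterate_mul, Nat.mul_sub_one, ← pow_two] at this

end ModP

section Lift

variable (p : ℕ) [hpf : Fact p.Prime]

/-- The localization of `ℤ` at `p` as a subring of `ℚ`. -/
def locS : Subring ℚ where
  carrier := {x | ¬ p ∣ x.den}
  mul_mem' := by
    intro a b ha hb h
    rcases hpf.out.dvd_mul.mp (h.trans (Rat.mul_den_dvd a b)) with h | h
    · exact ha h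
    · exact hb h
  one_mem' := by
    intro h
    exact hpf.out.one_lt.ne' (Nat.dvd_one.mp (by simpa using h))
  add_mem' := by
    intro a b ha hb h
    rcases hpf.out.dvd_mul.mp (h.trans (Rat.add_den_dvd a b)) with h | h
    · exact ha h
    · exact hb h
  zero_mem' := by
    intro h
    exact hpf.out.one_lt.ne' (Nat.dvd_one.mp (by simpa using h))
  neg_mem' := by
    intro a ha
    simpa using ha

lemma mem_locS (x : ℚ) : x ∈ locS p ↔ pInt p x := Iff.rfl

lemma den_ne (x : locS p) : ((x : ℚ).den : ZMod p) ≠ 0 := by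
  rw [Ne, ZMod.natCast_eq_zero_iff]; exact x.2

/-- Reduction modulo `p`. -/
def redS : locS p →+* ZMod p where
  toFun x := ((x : ℚ) : ZMod p)
  map_one' := by simp
  map_mul' x y := by
    rw [Subring.coe_mul, Rat.cast_mul_of_ne_zero (den_ne p x) (den_ne p y)]
  map_zero' := by simp
  map_add' x y := by
    rw [Subring.coe_add, Rat.cast_add_of_ne_zero (den_ne p x) (den_ne p y)]

lemma inv_mem_locS (d : ℕ) (hd : ¬ p ∣ d) : ((d : ℚ)⁻¹) ∈ locS p := by
  intro h
  apply hd
  rw [Rat.inv_natCast_den] at h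
  split_ifs at h with h0
  · exact absurd (Nat.dvd_one.mp h) hpf.out.one_lt.ne'
  · exact h

lemma redS_ker (x : locS p) (hx : redS p x = 0) : ∃ y : locS p, x = (p : locS p) * y := by
  have h : (((x : ℚ).num : ZMod p) / ((x : ℚ).den : ZMod p)) = 0 := by
    rw [← Rat.cast_def]; exact hx
  rw [div_eq_zero_iff, or_iff_left (den_ne p x), ZMod.intCast_zmod_eq_zero_iff_dvd] at h
  obtain ⟨c, hc⟩ := h
  refine ⟨(c : locS p) * ⟨_, inv_mem_locS p (x : ℚ).den x.2⟩, ?_⟩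
  apply Subtype.ext
  push_cast
  have hd : ((x : ℚ).den : ℚ) ≠ 0 := by exact_mod_cast (x : ℚ).den_ne_zero
  have : (x : ℚ) = ((x : ℚ).num : ℚ) / ((x : ℚ).den : ℚ) := (Rat.num_div_den _).symm
  rw [hc] at this
  push_cast at this
  rw [← mul_assoc, ← div_eq_mul_inv]
  exact this

lemma redS_surj : Function.Surjective (redS p) := by
  intro z
  obtain ⟨n, rfl⟩ := ZMod.natCast_zmod_surjective z
  exact ⟨n, map_natCast _ n⟩

lemma ker_redS : RingHom.ker (redS p) = Ideal.span {(p : locS p)} := by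
  ext x
  rw [RingHom.mem_ker, Ideal.mem_span_singleton]
  constructor
  · exact redS_ker p x
  · rintro ⟨y, rfl⟩
    rw [map_mul, map_natCast, CharP.cast_eq_zero, zero_mul]

lemma poly_ker (f : M3 (locS p)) (hf : MvPolynomial.map (redS p) f = 0) :
    ∃ g, f = (p : M3 (locS p)) * g := by
  have : f ∈ RingHom.ker (MvPolynomial.map (σ := Fin 3) (redS p)) := hf
  rw [MvPolynomial.ker_map, ker_redS, Ideal.map_span, Set.image_singleton,
    Ideal.mem_span_singleton, map_natCast] at this
  exact this

lemma poly_lift (f : Poly3) (hf : polyPInt p f) :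
    ∃ g : M3 (locS p), MvPolynomial.map (locS p).subtype g = f := by
  have : f ∈ Set.range (MvPolynomial.map (σ := Fin 3) (locS p).subtype) := by
    rw [MvPolynomial.mem_range_map_iff_coeffs_subset]
    intro x hx
    obtain ⟨m, _, rfl⟩ := MvPolynomial.mem_coeffs_iff.mp hx
    simpa [mem_locS] using hf m
  exact this

lemma polyPInt_map (g : M3 (locS p)) : polyPInt p (MvPolynomial.map (locS p).subtype g) := by
  intro m
  rw [coeff_map]
  exact (coeff m g).2

lemma map_inj_locS : Function.Injective
    (MvPolynomial.map (σ := Fin 3) (locS p).subtype) :=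
  MvPolynomial.map_injective _ Subtype.val_injective

lemma δ_noP {R : Type*} [CommRing R] (f : M3 R) (h : ∀ m ∈ f.support, m 0 = 0) :
    δR R f = 0 := by
  have : pderiv 0 f = 0 := by
    apply pderiv_eq_zero_of_notMem_vars
    rw [mem_vars_iff_mem_support]
    rintro ⟨m, hm, h0⟩
    exact (Finsupp.mem_support_iff.mp h0) (h m hm)
  simp [δR, this]

lemma supp_lift (f : Poly3) (g : M3 (locS p)) (h : MvPolynomial.map (locS p).subtype g = f) :
    (MvPolynomial.map (redS p) g).support ⊆ f.support := by
  rw [← h, support_map_of_injective (f := (locS p).subtype) g Subtype.val_injective]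
  exact support_map_subset _ _

lemma Dop_eq (f : Poly3) : Dop f = DR ℚ (1 / 12) f := by
  simp only [Dop, DR, Derivation.add_apply, Derivation.smul_apply, smul_eq_mul]
  norm_num

lemma Phi_eq : Phi = PhiR ℚ := by
  have h : ∀ c j n, PowerSeries.coeff n (eisR ℚ c j) = if n = 0 then 1 else c * sigmaQ j n := by
    intro c j n
    simp only [eisR, eis, sigmaQ, PowerSeries.coeff_map, PowerSeries.coeff_mk]
    split_ifs
    · simp
    · simp [ArithmeticFunction.sigma_apply]
  have h2 : E2s = eisR ℚ (-24) 1 := by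
    ext n; rw [h, E2s, PowerSeries.coeff_mk]; simp
  have h4 : E4s = eisR ℚ 240 3 := by
    ext n; rw [h, E4s, PowerSeries.coeff_mk]; simp
  have h6 : E6s = eisR ℚ (-504) 5 := by
    ext n; rw [h, E6s, PowerSeries.coeff_mk]; simp
  rw [Phi, PhiR, h2, h4, h6]

lemma bern_locS (hp5 : 5 ≤ p) :
    ∃ z : locS p, (p : ℚ) * bernoulli (p - 1) = -1 + p * (z : ℚ) := by
  have hodd := hpf.out.odd_of_ne_two (by omega)
  obtain ⟨j, hj⟩ := hodd
  have hj' : p - 1 = 2 * j := by omega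
  obtain ⟨N, hN⟩ := Bernoulli.vonStaudt_clausen j
  have hmem : p ∈ (range (2 * j + 2)).filter (fun q => q.Prime ∧ (q - 1) ∣ 2 * j) := by
    rw [mem_filter, mem_range]
    exact ⟨by omega, hpf.out, by rw [hj']⟩
  rw [← Finset.add_sum_erase _ _ hmem] at hN
  have hsum : ∑ q ∈ ((range (2 * j + 2)).filter (fun q => q.Prime ∧ (q - 1) ∣ 2 * j)).erase p,
      (1 : ℚ) / q ∈ locS p := by
    apply Subring.sum_mem
    intro q hq
    rw [mem_erase, mem_filter] at hq
    rw [one_div]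
    apply inv_mem_locS
    intro h
    exact hq.1 ((Nat.prime_dvd_prime_iff_eq hpf.out hq.2.2.1).mp h).symm
  refine ⟨(N : locS p) - ⟨_, hsum⟩, ?_⟩
  rw [hj']
  have hp0 : (p : ℚ) ≠ 0 := by exact_mod_cast hpf.out.ne_zero
  push_cast
  rw [hN]
  field_simp
  ring

lemma PhiA_one (hp5 : 5 ≤ p) (A : Poly3) (hAPhi : Phi A = EAs p) (g : M3 (locS p))
    (hg : MvPolynomial.map (locS p).subtype g = A) :
    PhiR (ZMod p) (MvPolynomial.map (redS p) g) = 1 := by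
  rw [PhiR_map]
  have hco : ∀ n, ((PowerSeries.coeff n (PhiR (locS p) g) : locS p) : ℚ)
      = PowerSeries.coeff n (EAs p) := by
    intro n
    rw [← hAPhi, Phi_eq, ← hg, PhiR_map, PowerSeries.coeff_map]; rfl
  ext n
  rw [PowerSeries.coeff_map, PowerSeries.coeff_one]
  have h := hco n
  set s := PowerSeries.coeff n (PhiR (locS p) g)
  rw [EAs, PowerSeries.coeff_mk] at h
  split_ifs at h ⊢ with h0
  · have : s = 1 := Subtype.ext h
    rw [this, map_one]
  · obtain ⟨z, hz⟩ := bern_locS p hp5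
    have hp0 : (p : ℚ) ≠ 0 := by exact_mod_cast hpf.out.ne_zero
    have hB : (bernoulli (p - 1) : ℚ) ≠ 0 := by
      intro hB
      rw [hB, mul_zero] at hz
      have : (1 : locS p) = p * z := by
        apply Subtype.ext; push_cast; linarith
      have := congrArg (redS p) this
      rw [map_mul, map_natCast, CharP.cast_eq_zero, zero_mul, map_one] at this
      exact one_ne_zero this
    have hs : s * (-1 + p * z) = p * (-(2 * (p - 1)) * ∑ d ∈ n.divisors, (d : locS p) ^ (p - 2)) := by
      apply Subtype.ext
      push_cast
      rw [← hz, h, sigmaQ]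
      field_simp
      have h2 : ((2 : locS p) : ℚ) = 2 := rfl
      rw [h2]; ring
    have := congrArg (redS p) hs
    rw [map_mul, map_mul, map_add, map_mul, map_natCast, CharP.cast_eq_zero, zero_mul, zero_mul,
      add_zero, map_neg, map_one] at this
    simpa using this

lemma coeff_high (w : ℕ) (h g : Poly3) (hh : Wt (w : ℤ) h) (m : Fin 3 →₀ ℕ)
    (hm : 2 * m 0 + 4 * m 1 + 6 * m 2 < w) : coeff m (h * g) = 0 := by
  rw [coeff_mul]
  apply Finset.sum_eq_zero
  rintro ⟨a, b⟩ hab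
  rw [HasAntidiagonal.mem_antidiagonal] at hab
  dsimp only at hab ⊢
  by_cases ha : coeff a h = 0
  · rw [ha, zero_mul]
  · exfalso
    have := (wt_iff _ _).mp hh a (mem_support_iff.mpr ha)
    rw [← hab] at hm
    simp only [Finsupp.add_apply] at hm
    omega

lemma isob_wt (w : ℕ) (f : Poly3) (hf : Isobaric w f) : Wt (w : ℤ) f := by
  rw [wt_iff]
  intro m hm
  exact_mod_cast hf m hm

lemma divide_F (hp5 : 5 ≤ p) (A : Poly3) (hA : Isobaric (p - 1) A) (k : ℕ) (hk : k ≤ p)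
    (F : Poly3) (hF : Isobaric k F) (n : ℕ) (h : InIdealPow p A n F) :
    ∃ g : M3 (locS p), (p : Poly3) ^ n * MvPolynomial.map (locS p).subtype g = F := by
  obtain ⟨G, hG, hsum⟩ := h
  have hp0 : (p : ℚ) ≠ 0 := by exact_mod_cast hpf.out.ne_zero
  have hCp : (p : Poly3) ^ n = C ((p : ℚ) ^ n) := by simp
  have hco : ∀ m ∈ F.support, coeff m F = (p : ℚ) ^ n * coeff m (G 0) := by
    intro m hm
    have hwm := hF m hm
    conv_lhs => rw [hsum, Finset.sum_range_succ', coeff_add, coeff_sum]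
    rw [Finset.sum_eq_zero, zero_add]
    · rw [mul_zero, pow_zero, mul_one, Nat.sub_zero, hCp, coeff_C_mul]
    · intro i _
      have : (p : Poly3) ^ (n - (i + 1)) * A ^ (p * (i + 1)) * G (i + 1)
          = A ^ (p * (i + 1)) * ((p : Poly3) ^ (n - (i + 1)) * G (i + 1)) := by ring
      rw [this]
      refine coeff_high (p * (i + 1) * (p - 1)) _ _ ?_ m ?_
      · exact ((isob_wt _ _ hA).pow _).cast (by push_cast; ring)
      · rw [hwm]
        obtain ⟨q, rfl⟩ : ∃ q, p = q + 2 := ⟨p - 2, by omega⟩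
        have : q + 2 - 1 = q + 1 := rfl
        rw [this]
        nlinarith [Nat.zero_le (i * q), Nat.zero_le (i * q * q), Nat.zero_le (q * q)]
  obtain ⟨g, hg⟩ := poly_lift p (C (((p : ℚ) ^ n)⁻¹) * F) (by
    intro m
    rw [coeff_C_mul]
    by_cases hm : m ∈ F.support
    · rw [hco m hm, inv_mul_cancel_left₀ (pow_ne_zero n hp0)]
      exact hG 0 m
    · rw [notMem_support_iff.mp hm, mul_zero]
      exact (locS p).zero_mem)
  refine ⟨g, ?_⟩
  rw [hg, hCp, ← mul_assoc, ← map_mul, mul_inv_cancel₀ (pow_ne_zero n hp0), map_one, one_mul]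

lemma iter_map {R S : Type*} [CommRing R] [CommRing S] (φ : R →+* S) (t : R) (n : ℕ) (f : M3 R) :
    (DR S (φ t))^[n] (MvPolynomial.map φ f) = MvPolynomial.map φ ((DR R t)^[n] f) := by
  induction n with
  | zero => rfl
  | succ n ih => rw [Function.iterate_succ_apply', ih, DR_map, Function.iterate_succ_apply']

lemma iter_natpow (n j : ℕ) (f : Poly3) :
    Dop^[j] ((p : Poly3) ^ n * f) = (p : Poly3) ^ n * Dop^[j] f := by
  have hCp : (p : Poly3) ^ n = C ((p : ℚ) ^ n) := by simp
  induction j with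
  | zero => rfl
  | succ j ih =>
    rw [Function.iterate_succ_apply', ih, Function.iterate_succ_apply', Dop_eq, Dop_eq, hCp,
      ← smul_eq_C_mul, ← smul_eq_C_mul, Derivation.map_smul]

theorem main_lift (hp5 : 5 ≤ p)
    (A : Poly3) (hAiso : Isobaric (p - 1) A) (hAnoP : NoP A)
    (hAint : polyPInt p A) (hAPhi : Phi A = EAs p)
    (k : ℕ) (hk2 : 2 ≤ k) (hkp : k ≤ p) (F : Poly3) (hFiso : Isobaric k F) (hFnoP : NoP F)
    (n : ℕ) (hF : InIdealPow p A n F) :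
    InIdealPow p A (n + 1) (Dop^[p ^ 2 - p] F) := by
  obtain ⟨g, hg⟩ := divide_F p hp5 A hAiso k hkp F hFiso n hF
  obtain ⟨a, ha⟩ := poly_lift p A hAint
  have hp0 : (p : ℚ) ≠ 0 := by exact_mod_cast hpf.out.ne_zero
  have hgs : (MvPolynomial.map (redS p) g).support ⊆ F.support := by
    refine (supp_lift p _ g rfl).trans ?_
    intro m hm
    have hCp : (p : Poly3) ^ n = C ((p : ℚ) ^ n) := by simp
    rw [mem_support_iff, ← hg, hCp, coeff_C_mul]
    exact mul_ne_zero (pow_ne_zero n hp0) (mem_support_iff.mp hm)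
  have has := supp_lift p A a ha
  have h12 : ¬ p ∣ 12 := by
    intro h
    have h' : p ∣ 2 ^ 2 * 3 := h
    rcases hpf.out.dvd_mul.mp h' with h | h
    · have := Nat.le_of_dvd (by norm_num) (hpf.out.dvd_of_dvd_pow h); omega
    · have := Nat.le_of_dvd (by norm_num) h; omega
  let t : locS p := ⟨((12 : ℕ) : ℚ)⁻¹, inv_mem_locS p 12 h12⟩
  have ht : 12 * t = 1 := by
    apply Subtype.ext
    change (12 : ℚ) * ((12 : ℕ) : ℚ)⁻¹ = 1
    norm_num
  have ht2 : (locS p).subtype t = 1 / 12 := by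
    change ((12 : ℕ) : ℚ)⁻¹ = 1 / 12
    norm_num
  have hmain := modp_main p hp5 (redS p t)
    (by rw [← map_ofNat (redS p) 12, ← map_mul, ht, map_one])
    (MvPolynomial.map (redS p) a)
    (by
      rw [wt_iff]; intro m hm
      have := hAiso m (has hm)
      omega)
    (δ_noP _ fun m hm => hAnoP m (has hm))
    (PhiA_one p hp5 A hAPhi a ha) k hk2 hkp (MvPolynomial.map (redS p) g)
    (by
      rw [wt_iff]; intro m hm
      have := hFiso m (hgs hm)
      omega)
    (δ_noP _ fun m hm => hFnoP m (hgs hm))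
  rw [iter_map] at hmain
  obtain ⟨M, hM⟩ := hmain
  obtain ⟨M', rfl⟩ := MvPolynomial.map_surjective (redS p) (redS_surj p) M
  obtain ⟨N, hN⟩ := poly_ker p ((DR (locS p) t)^[p ^ 2 - p] g - a ^ p * M') (by
    rw [map_sub, hM, map_mul, map_pow, sub_self])
  have hfin : Dop^[p ^ 2 - p] (MvPolynomial.map (locS p).subtype g)
      = A ^ p * MvPolynomial.map (locS p).subtype M'
        + (p : Poly3) * MvPolynomial.map (locS p).subtype N := by
    have hDD : Dop = DR ℚ ((locS p).subtype t) := by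
      ext1 f; rw [Dop_eq, ht2]
    rw [hDD, iter_map, ← ha, ← map_pow, ← map_mul,
      ← map_natCast (MvPolynomial.map (σ := Fin 3) (locS p).subtype) p, ← map_mul, ← map_add, ← hN]
    congr 1; ring
  refine ⟨fun i => if i = 0 then MvPolynomial.map (locS p).subtype N
    else if i = 1 then MvPolynomial.map (locS p).subtype M' else 0, ?_, ?_⟩
  · intro i
    dsimp only
    split_ifs
    · exact polyPInt_map p N
    · exact polyPInt_map p M'
    · intro m; rw [coeff_zero]; exact (locS p).zero_mem
  · rw [← hg, iter_natpow, hfin, Finset.sum_range_succ', Finset.sum_range_succ']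
    rw [Finset.sum_eq_zero]
    · simp only [zero_add, if_true, one_ne_zero, if_false, mul_one, mul_zero, pow_zero,
        Nat.sub_zero, Nat.add_sub_cancel]
      ring
    · intro i _
      simp

end Lift

theorem stmt_17 (p : ℕ) (hp : p.Prime) (hp5 : 5 ≤ p)
    (A : Poly3) (hAiso : Isobaric (p - 1) A) (hAnoP : NoP A)
    (hAint : polyPInt p A) (hAPhi : Phi A = EAs p)
    (k : ℕ) (hk : 0 < k) (F : Poly3) (hFiso : Isobaric k F) (hFnoP : NoP F)
    (hFint : polyPInt p F) (hpk : 2 * k - 2 ≤ p)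
    (n : ℕ) (hn : n ≤ k - 2) (hF : InIdealPow p A n F) :
    InIdealPow p A (n + 1) (Dop^[p ^ 2 - p] F) := by
  haveI : Fact p.Prime := ⟨hp⟩
  by_cases hk2 : 2 ≤ k
  · exact main_lift p hp5 A hAiso hAnoP hAint hAPhi k hk2 (by omega) F hFiso hFnoP n hF
  · have hF0 : F = 0 := by
      by_contra hne
      obtain ⟨m, hm⟩ := support_nonempty.mpr hne
      have := hFiso m hm
      omega
    have hD0 : ∀ j, Dop^[j] (0 : Poly3) = 0 := by
      intro j
      induction j with
      | zero => rfl
      | succ j ih => rw [Function.iterate_succ_apply', ih, Dop_eq, map_zero]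
    rw [hF0, hD0]
    refine ⟨fun _ => 0, fun _ m => ?_, by simp⟩
    rw [coeff_zero]
    exact (locS p).zero_mem
end
end
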